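/- A Schur function s admits a pseudocontinuation of bounded type across an arc γ of the unit circle if and only if there exists a 2×2 matrix function S with Schur function entries, with s as its (2,2) entry, whose boundary values are unitary a.e. on γ. -/

import Mathlib

open MeasureTheory Filter Complex Set Matrix

noncomputable section

/-- The open unit disk. -/
def unitDisk : Set ℂ := {z : ℂ | ‖z‖ < 1}

/-- The exterior of the closed unit disk. -/
def extDisk : Set ℂ := {z : ℂ | 1 < ‖z‖}

/-- Point on the unit circle with angle `θ`. -/
def circlePt (θ : ℝ) : ℂ := Complex.exp (θ * Complex.I)

/-- One full period of angles, parametrizing the circle 𝕋. -/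
def circleSet : Set ℝ := Set.Ioc 0 (2 * Real.pi)

/-- `RadLim f θ w` : the radial (nontangential) boundary value of `f` (analytic in the
disk) at the boundary point `circlePt θ` exists and equals `w`. -/
def RadLim (f : ℂ → ℂ) (θ : ℝ) (w : ℂ) : Prop :=
  Filter.Tendsto (fun r : ℝ => f ((r : ℂ) * circlePt θ))
    (nhdsWithin 1 (Set.Iio 1)) (nhds w)

/-- `RadLimExt f θ w` : the radial boundary value of `f` (analytic in the exterior disk)
at the boundary point `circlePt θ`, taken from outside. -/
def RadLimExt (f : ℂ → ℂ) (θ : ℝ) (w : ℂ) : Prop :=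
  Filter.Tendsto (fun r : ℝ => f ((r : ℂ) * circlePt θ))
    (nhdsWithin 1 (Set.Ioi 1)) (nhds w)

/-- A Schur function: analytic on the unit disk and bounded by 1 in modulus. -/
def SchurFn (f : ℂ → ℂ) : Prop :=
  DifferentiableOn ℂ f unitDisk ∧ ∀ z ∈ unitDisk, ‖f z‖ ≤ 1

/-- The Nevanlinna class on a domain `Ω` : quotients of two bounded (contractive)
analytic functions, with not-identically-zero denominator. -/
def NevOn (Ω : Set ℂ) (f : ℂ → ℂ) : Prop :=
  ∃ f₁ f₂ : ℂ → ℂ, DifferentiableOn ℂ f₁ Ω ∧ DifferentiableOn ℂ f₂ Ω ∧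
    (∀ z ∈ Ω, ‖f₁ z‖ ≤ 1) ∧ (∀ z ∈ Ω, ‖f₂ z‖ ≤ 1) ∧
    (∃ z ∈ Ω, f₂ z ≠ 0) ∧ (∀ z ∈ Ω, f₂ z ≠ 0 → f z = f₁ z / f₂ z)

/-- An arc of the unit circle, described by its set of angles (one full period is
`Set.Ioo 0 (2π)` up to a null set, so the case γ = 𝕋 is not excluded). -/
def IsArc (γ : Set ℝ) : Prop :=
  ∃ a b : ℝ, 0 ≤ a ∧ a < b ∧ b ≤ 2 * Real.pi ∧ γ = Set.Ioo a b

/-- `f` admits a pseudocontinuation of bounded type across the arc with angle set `γ` :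
there is a Nevanlinna function on the exterior disk whose boundary values agree with
those of `f` a.e. on `γ`. -/
def PCArc (f : ℂ → ℂ) (γ : Set ℝ) : Prop :=
  ∃ ft : ℂ → ℂ, NevOn extDisk ft ∧
    ∀ᵐ θ ∂(volume.restrict γ), ∃ w : ℂ, RadLim f θ w ∧ RadLimExt ft θ w

/-- The boundary values of `f` exist and are unimodular a.e. on `γ`. -/
def UnimodularAEOn (f : ℂ → ℂ) (γ : Set ℝ) : Prop :=
  ∀ᵐ θ ∂(volume.restrict γ), ∃ w : ℂ, RadLim f θ w ∧ ‖w‖ = 1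

/-- The boundary values of the 2×2 matrix function `S` exist and are unitary a.e. on `γ`. -/
def UnitaryAEOn (S : ℂ → Matrix (Fin 2) (Fin 2) ℂ) (γ : Set ℝ) : Prop :=
  ∀ᵐ θ ∂(volume.restrict γ), ∃ W : Matrix (Fin 2) (Fin 2) ℂ,
    (∀ i j, RadLim (fun z => S z i j) θ (W i j)) ∧ Wᴴ * W = 1

/-- An outer function on the unit disk (normalized, with multiplicative constant 1):
`f z = exp (∫_𝕋 (t+z)/(t-z) φ(t) dm(t))` for some real integrable boundary data `φ`,
`m` being normalized Lebesgue measure on 𝕋. -/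
def IsOuter (f : ℂ → ℂ) : Prop :=
  ∃ φ : ℝ → ℝ, IntegrableOn φ circleSet ∧
    ∀ z ∈ unitDisk, f z =
      Complex.exp (∫ θ in circleSet,
        ((circlePt θ + z) / (circlePt θ - z)) * (φ θ : ℂ) / (2 * Real.pi))

open ComplexConjugate

/-- The Poisson kernel of the unit circle in angular coordinates. -/
def angKernel (r t : ℝ) : ℝ := (1 - r ^ 2) / (1 - 2 * r * Real.cos t + r ^ 2)

/-- The derivative of `angKernel r` in the angle. -/
def angKernelDeriv (r t : ℝ) : ℝ :=
  -((1 - r ^ 2) * (2 * r * Real.sin t)) / (1 - 2 * r * Real.cos t + r ^ 2) ^ 2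

lemma angKernel_denom_pos {r : ℝ} (h0 : 0 ≤ r) (h1 : r < 1) (t : ℝ) :
    0 < 1 - 2 * r * Real.cos t + r ^ 2 := by
  nlinarith [Real.cos_le_one t, sq_pos_of_pos (sub_pos.2 h1)]

lemma hasDerivAt_angKernel {r : ℝ} (h0 : 0 ≤ r) (h1 : r < 1) (t : ℝ) :
    HasDerivAt (angKernel r) (angKernelDeriv r t) t := by
  have hd := angKernel_denom_pos h0 h1 t
  have h : HasDerivAt (fun t => 1 - 2 * r * Real.cos t + r ^ 2) (2 * r * Real.sin t) t := by
    have := (((Real.hasDerivAt_cos t).const_mul (2 * r)).const_sub 1).add_const (r ^ 2)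
    convert! this using 1
    ring
  have := (hasDerivAt_const t (1 - r ^ 2)).div h hd.ne'
  convert! this using 1
  rw [angKernelDeriv]
  ring

lemma continuous_angKernelDeriv {r : ℝ} (h0 : 0 ≤ r) (h1 : r < 1) :
    Continuous (angKernelDeriv r) := by
  unfold angKernelDeriv
  exact Continuous.div (by fun_prop) (by fun_prop)
    fun t => (pow_pos (angKernel_denom_pos h0 h1 t) 2).ne'

lemma circleMap_eq_circlePt (θ : ℝ) : circleMap 0 1 θ = circlePt θ := by
  simp [circleMap, circlePt]

lemma norm_circlePt (θ : ℝ) : ‖circlePt θ‖ = 1 := Complex.norm_exp_ofReal_mul_I θ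

lemma poissonKernel_eq_angKernel {r : ℝ} (θ t : ℝ) :
    poissonKernel 0 (r * circlePt θ) (circleMap 0 1 t) = angKernel r (t - θ) := by
  rw [circleMap_eq_circlePt, poissonKernel, angKernel]
  simp only [sub_zero, norm_mul, norm_circlePt, Complex.norm_real, Real.norm_eq_abs, mul_one,
    sq_abs, one_pow]
  congr 1
  rw [← Complex.normSq_eq_norm_sq, Complex.normSq_apply, circlePt, circlePt]
  simp only [Complex.exp_ofReal_mul_I, add_re, sub_re, mul_re, add_im, sub_im, mul_im, I_re, I_im,
    ofReal_re, ofReal_im, Real.cos_sub]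
  linear_combination Real.sin_sq_add_cos_sq t + r ^ 2 * Real.sin_sq_add_cos_sq θ

/-- The Poisson integral over the circle as an integral over a period centred at the angle of
the evaluation point. -/
lemma circleAverage_poissonKernel_eq_intervalIntegral {E : Type*} [NormedAddCommGroup E]
    [NormedSpace ℝ E] (g : ℂ → E) (r θ : ℝ) :
    Real.circleAverage (poissonKernel 0 (r * circlePt θ) • g) 0 1 =
      (2 * Real.pi)⁻¹ •
        ∫ t in (-Real.pi)..Real.pi, angKernel r t • g (circleMap 0 1 (θ + t)) := by
  rw [Real.circleAverage_def]
  congr 1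
  have hp : Function.Periodic (fun t => (poissonKernel 0 (r * circlePt θ) • g) (circleMap 0 1 t))
      (2 * Real.pi) := (periodic_circleMap 0 1).comp _
  have h1 := hp.intervalIntegral_add_eq 0 (-Real.pi + θ)
  rw [zero_add] at h1
  rw [h1, show -Real.pi + θ + 2 * Real.pi = Real.pi + θ by ring,
    ← intervalIntegral.integral_comp_add_right]
  refine intervalIntegral.integral_congr fun t _ => ?_
  simp only [Pi.smul_apply', poissonKernel_eq_angKernel, add_comm t θ,
    add_sub_cancel_left]

lemma integral_angKernel {r : ℝ} (h0 : 0 ≤ r) (h1 : r < 1) :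
    ∫ t in (-Real.pi)..Real.pi, angKernel r t = 2 * Real.pi := by
  have h := circleAverage_poissonKernel_eq_intervalIntegral (fun _ => (1 : ℂ)) r 0
  have h2 : Real.circleAverage (poissonKernel 0 (r * circlePt 0) • fun _ => (1 : ℂ)) 0 1 = 1 := by
    refine DiffContOnCl.circleAverage_poissonKernel_smul (diffContOnCl_const) ?_
    simp [norm_circlePt, abs_of_nonneg h0, h1]
  rw [h2] at h
  simp only [Complex.real_smul, mul_one] at h
  rw [intervalIntegral.integral_ofReal] at h
  have hpi := Real.pi_pos
  norm_cast at h
  field_simp at h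
  linarith

lemma tendsto_angKernel_pi :
    Tendsto (fun r => angKernel r Real.pi) (nhdsWithin 1 (Iio 1)) (nhds 0) := by
  have : Tendsto (fun r => angKernel r Real.pi) (nhds 1) (nhds (angKernel 1 Real.pi)) := by
    unfold angKernel
    refine Tendsto.div (Continuous.tendsto (by fun_prop) _) (Continuous.tendsto (by fun_prop) _) ?_
    norm_num
  simpa [angKernel] using this.mono_left nhdsWithin_le_nhds

/-- Near the point `1`, the radii in `(0, 1)`. -/
lemma eventually_radius : ∀ᶠ r : ℝ in nhdsWithin 1 (Iio 1), 0 < r ∧ r < 1 := by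
  filter_upwards [Ioo_mem_nhdsLT (show (0 : ℝ) < 1 by norm_num)] with r hr using hr

lemma tendsto_integral_peak : Tendsto
    (fun r => ∫ t in Icc (-Real.pi) Real.pi, (2 * Real.pi)⁻¹ * (-(t * angKernelDeriv r t)))
    (nhdsWithin 1 (Iio 1)) (nhds 1) := by
  have h : Tendsto (fun r => 1 - angKernel r Real.pi) (nhdsWithin 1 (Iio 1)) (nhds 1) := by
    simpa using tendsto_angKernel_pi.const_sub 1
  refine h.congr' ?_
  filter_upwards [eventually_radius] with r ⟨h0, h1⟩
  have hpi := Real.pi_pos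
  rw [integral_Icc_eq_integral_Ioc, ← intervalIntegral.integral_of_le (by linarith),
    intervalIntegral.integral_const_mul, intervalIntegral.integral_neg,
    intervalIntegral.integral_mul_deriv_eq_deriv_mul (u := fun t => t) (u' := fun _ => 1)
      (v := angKernel r) (fun t _ => hasDerivAt_id' t) (fun t _ => hasDerivAt_angKernel h0.le h1 t)
      (by simp) ((continuous_angKernelDeriv h0.le h1).intervalIntegrable _ _)]
  simp only [one_mul]
  rw [integral_angKernel h0.le h1, show angKernel r (-Real.pi) = angKernel r Real.pi by
    simp [angKernel]]
  field_simp
  ring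

/-- Integrating `-∂P_r/∂t` against `G` differentiates `G` as `r → 1`. -/
lemma tendsto_integral_angKernelDeriv {E : Type*} [NormedAddCommGroup E] [NormedSpace ℝ E]
    [CompleteSpace E] {G : ℝ → E} (hG : Continuous G) {A : E} (hA : HasDerivAt G A 0) :
    Tendsto (fun r => (2 * Real.pi)⁻¹ • ∫ t in (-Real.pi)..Real.pi, (-angKernelDeriv r t) • G t)
      (nhdsWithin 1 (Iio 1)) (nhds A) := by
  have hpi := Real.pi_pos
  have hcd : Continuous (dslope G 0) := by
    rw [continuous_iff_continuousAt]
    intro t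
    by_cases ht : t = 0
    · subst ht
      exact continuousAt_dslope_same.2 hA.differentiableAt
    · exact (continuousAt_dslope_of_ne ht).2 hG.continuousAt
  have key := tendsto_setIntegral_peak_smul_of_integrableOn_of_tendsto
    (μ := volume) (s := Icc (-Real.pi) Real.pi) (t := Icc (-Real.pi) Real.pi) (x₀ := (0 : ℝ))
    (l := nhdsWithin (1 : ℝ) (Iio 1)) (g := dslope G 0) (a := A)
    (φ := fun r t => (2 * Real.pi)⁻¹ * (-(t * angKernelDeriv r t)))
    measurableSet_Icc measurableSet_Icc subset_rfl self_mem_nhdsWithin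
    isCompact_Icc.measure_lt_top.ne ?_ ?_ tendsto_integral_peak ?_
    hcd.continuousOn.integrableOn_Icc ?_
  · refine key.congr' ?_
    filter_upwards [eventually_radius] with r ⟨h0, h1⟩
    have hsplit : ∫ t in (-Real.pi)..Real.pi, (-angKernelDeriv r t) • G 0 = 0 := by
      rw [intervalIntegral.integral_smul_const, intervalIntegral.integral_neg,
        intervalIntegral.integral_eq_sub_of_hasDerivAt
          (fun t _ => hasDerivAt_angKernel h0.le h1 t)
          ((continuous_angKernelDeriv h0.le h1).intervalIntegrable _ _)]
      simp [angKernel]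
    have hc := continuous_angKernelDeriv h0.le h1
    rw [← sub_zero (∫ t in (-Real.pi)..Real.pi, (-angKernelDeriv r t) • G t), ← hsplit,
      ← intervalIntegral.integral_sub ((by fun_prop : Continuous _).intervalIntegrable _ _)
        ((by fun_prop : Continuous _).intervalIntegrable _ _),
      ← intervalIntegral.integral_smul, integral_Icc_eq_integral_Ioc,
      ← intervalIntegral.integral_of_le (by linarith)]
    refine intervalIntegral.integral_congr fun t _ => ?_
    rw [← smul_sub, mul_smul, ← mul_neg, mul_comm t, mul_smul, ← sub_smul_dslope G 0 t, sub_zero]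
  · filter_upwards [eventually_radius] with r ⟨h0, h1⟩ t ht
    have hts : 0 ≤ t * Real.sin t := by
      rcases le_total 0 t with h | h
      · exact mul_nonneg h (Real.sin_nonneg_of_nonneg_of_le_pi h ht.2)
      · have := Real.sin_nonpos_of_nonpos_of_neg_pi_le h ht.1
        nlinarith
    have hd := angKernel_denom_pos h0.le h1 t
    rw [angKernelDeriv, show -(t * (-((1 - r ^ 2) * (2 * r * Real.sin t)) /
      (1 - 2 * r * Real.cos t + r ^ 2) ^ 2)) = (1 - r ^ 2) * (2 * r * (t * Real.sin t)) /
      (1 - 2 * r * Real.cos t + r ^ 2) ^ 2 by ring]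
    have : 0 ≤ 1 - r ^ 2 := by nlinarith
    positivity
  · intro u hu h0u
    obtain ⟨δ, hδ, hδu⟩ := Metric.isOpen_iff.1 hu 0 h0u
    set d := min δ (Real.pi / 2) with hd
    have hd0 : 0 < d := lt_min hδ (by linarith)
    have hdpi : d ≤ Real.pi / 2 := min_le_right _ _
    have hsin : 0 < Real.sin d := Real.sin_pos_of_pos_of_lt_pi hd0 (by linarith)
    have hlim : Tendsto (fun r : ℝ => (1 - r ^ 2) / Real.sin d ^ 4) (nhdsWithin 1 (Iio 1))
        (nhds 0) := by
      have : Tendsto (fun r : ℝ => (1 - r ^ 2) / Real.sin d ^ 4) (nhds 1)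
          (nhds ((1 - 1 ^ 2) / Real.sin d ^ 4)) :=
        Continuous.tendsto (by fun_prop) _
      simpa using this.mono_left nhdsWithin_le_nhds
    rw [Metric.tendstoUniformlyOn_iff]
    intro ε hε
    filter_upwards [eventually_radius, hlim.eventually (gt_mem_nhds hε)] with r ⟨h0, h1⟩ hr t ht
    have htδ : d ≤ |t| := by
      by_contra hlt
      push Not at hlt
      refine ht.2 (hδu ?_)
      simpa using hlt.trans_le (min_le_left _ _)
    have htpi : |t| ≤ Real.pi := abs_le.2 ht.1
    have hcos : Real.cos t ≤ Real.cos d := by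
      rw [← Real.cos_abs t]
      exact Real.cos_le_cos_of_nonneg_of_le_pi hd0.le htpi htδ
    have hcd0 : 0 ≤ Real.cos d := Real.cos_nonneg_of_mem_Icc ⟨by linarith, hdpi⟩
    have hden : Real.sin d ^ 2 ≤ 1 - 2 * r * Real.cos t + r ^ 2 := by
      nlinarith [Real.sin_sq_add_cos_sq d, sq_nonneg (r - Real.cos d)]
    have hr2 : 0 < 1 - r ^ 2 := by nlinarith
    simp only [Pi.zero_apply, dist_zero_left, Real.norm_eq_abs]
    refine lt_of_le_of_lt ?_ hr
    rw [angKernelDeriv, abs_mul, abs_neg, abs_mul, abs_div, abs_neg, abs_mul, abs_mul, abs_mul,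
      abs_of_pos (by positivity : (0:ℝ) < (2 * Real.pi)⁻¹), abs_of_pos hr2, abs_two, abs_of_pos h0,
      abs_sq]
    have hs1 : |Real.sin t| ≤ 1 := Real.abs_sin_le_one t
    have hp4 : Real.sin d ^ 4 ≤ (1 - 2 * r * Real.cos t + r ^ 2) ^ 2 := by
      calc Real.sin d ^ 4 = (Real.sin d ^ 2) ^ 2 := by ring
        _ ≤ _ := by gcongr
    calc (2 * Real.pi)⁻¹ * (|t| * ((1 - r ^ 2) * (2 * r * |Real.sin t|) /
          (1 - 2 * r * Real.cos t + r ^ 2) ^ 2))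
        ≤ (2 * Real.pi)⁻¹ * (Real.pi * ((1 - r ^ 2) * (2 * 1 * 1) / Real.sin d ^ 4)) := by
          gcongr
      _ = (1 - r ^ 2) / Real.sin d ^ 4 := by field_simp
  · filter_upwards [eventually_radius] with r ⟨h0, h1⟩
    have := continuous_angKernelDeriv h0.le h1
    exact Continuous.aestronglyMeasurable (by fun_prop)
  · have := hcd.continuousWithinAt (s := Icc (-Real.pi) Real.pi) (x := 0)
    rwa [ContinuousWithinAt, dslope_same, hA.deriv] at this

/-- The Poisson integral of a function on the unit circle. -/
def poissonInt (u : ℂ → ℝ) (z : ℂ) : ℝ := Real.circleAverage (poissonKernel 0 z • u) 0 1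

lemma intervalIntegrable_circle {E : Type*} [NormedAddCommGroup E] {u : ℂ → E}
    (hu : CircleIntegrable u 0 1) (a b : ℝ) :
    IntervalIntegrable (fun t => u (circleMap 0 1 t)) volume a b :=
  Function.Periodic.intervalIntegrable₀ (fun t => by rw [periodic_circleMap]) (by positivity)
    hu a b

lemma locallyIntegrable_circle {E : Type*} [NormedAddCommGroup E] {u : ℂ → E}
    (hu : CircleIntegrable u 0 1) : LocallyIntegrable (fun t => u (circleMap 0 1 t)) := by
  rw [locallyIntegrable_iff]
  intro K hK
  obtain ⟨a, ha⟩ := hK.bddBelow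
  obtain ⟨b, hb⟩ := hK.bddAbove
  rcases le_total a b with hab | hab
  · have := (intervalIntegrable_iff_integrableOn_Icc_of_le hab).1 (intervalIntegrable_circle hu a b)
    exact this.mono_set fun x hx => ⟨ha hx, hb hx⟩
  · have := (intervalIntegrable_iff_integrableOn_Icc_of_le hab).1 (intervalIntegrable_circle hu b a)
    exact this.mono_set fun x hx => ⟨hab.trans (ha hx), (hb hx).trans hab⟩

/-- **Fatou's theorem for Poisson integrals**: radial limits of the Poisson integral of an
integrable function. -/
theorem ae_tendsto_poissonInt {u : ℂ → ℝ} (hu : CircleIntegrable u 0 1) :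
    ∀ᵐ θ : ℝ, Tendsto (fun r : ℝ => poissonInt u (r * circlePt θ)) (nhdsWithin 1 (Iio 1))
      (nhds (u (circlePt θ))) := by
  filter_upwards [LocallyIntegrable.ae_hasDerivAt_integral (locallyIntegrable_circle hu)] with θ hθ
  set w : ℝ → ℝ := fun s => u (circleMap 0 1 (θ + s)) with hw
  have hwi : ∀ a b, IntervalIntegrable w volume a b := fun a b => by
    have := (intervalIntegrable_circle hu (a + θ) (b + θ)).comp_add_left θ
    simpa using this
  set G : ℝ → ℝ := fun t => ∫ s in (0 : ℝ)..t, w s with hG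
  have hG' : G = fun t => ∫ s in θ..(θ + t), u (circleMap 0 1 s) := by
    ext t
    rw [hG]
    simp only [hw]
    rw [intervalIntegral.integral_comp_add_left (fun s => u (circleMap 0 1 s)), add_zero]
  have hGd : HasDerivAt G (u (circlePt θ)) 0 := by
    rw [hG', ← circleMap_eq_circlePt]
    have h := hθ θ
    rw [← add_zero θ] at h
    simpa using h.comp_const_add θ 0
  have hGc : Continuous G := intervalIntegral.continuous_primitive (fun a b => hwi a b) 0
  have hwl : LocallyIntegrable w := by
    rw [locallyIntegrable_iff]
    intro K hK
    obtain ⟨a, ha⟩ := (hK.union (isCompact_singleton (x := (0:ℝ)))).bddBelow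
    obtain ⟨b, hb⟩ := (hK.union (isCompact_singleton (x := (0:ℝ)))).bddAbove
    have hab : a ≤ b := (ha (Or.inr rfl)).trans (hb (Or.inr rfl))
    exact ((intervalIntegrable_iff_integrableOn_Icc_of_le hab).1 (hwi a b)).mono_set
      fun x hx => ⟨ha (Or.inl hx), hb (Or.inl hx)⟩
  have hGderiv : ∀ᵐ t, deriv G t = w t := by
    filter_upwards [LocallyIntegrable.ae_hasDerivAt_integral hwl] with t ht using (ht 0).deriv
  have hpi := Real.pi_pos
  have key : ∀ r : ℝ, 0 < r ∧ r < 1 → poissonInt u (r * circlePt θ) =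
      (2 * Real.pi)⁻¹ * (angKernel r Real.pi * (G Real.pi - G (-Real.pi))) +
      (2 * Real.pi)⁻¹ • ∫ t in (-Real.pi)..Real.pi, (-angKernelDeriv r t) • G t := by
    rintro r ⟨h0, h1⟩
    rw [poissonInt, circleAverage_poissonKernel_eq_intervalIntegral]
    have h2 : ∫ t in (-Real.pi)..Real.pi, angKernel r t • u (circleMap 0 1 (θ + t)) =
        ∫ t in (-Real.pi)..Real.pi, angKernel r t * deriv G t := by
      refine intervalIntegral.integral_congr_ae ?_
      filter_upwards [hGderiv] with t ht _
      rw [ht, smul_eq_mul]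
    have hcd : ContDiff ℝ 1 (angKernel r) := by
      rw [contDiff_one_iff_deriv]
      refine ⟨fun t => (hasDerivAt_angKernel h0.le h1 t).differentiableAt, ?_⟩
      rw [show deriv (angKernel r) = angKernelDeriv r from
        funext fun t => (hasDerivAt_angKernel h0.le h1 t).deriv]
      exact continuous_angKernelDeriv h0.le h1
    rw [h2, AbsolutelyContinuousOnInterval.integral_mul_deriv_eq_deriv_mul
      hcd.contDiffOn.absolutelyContinuousOnInterval
      ((hwi _ _).absolutelyContinuousOnInterval_intervalIntegral (by
        rw [uIcc_of_le (by linarith)]; constructor <;> linarith)),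
      show deriv (angKernel r) = angKernelDeriv r from
        funext fun t => (hasDerivAt_angKernel h0.le h1 t).deriv]
    have he : angKernel r (-Real.pi) = angKernel r Real.pi := by simp [angKernel]
    simp only [he, smul_eq_mul, neg_mul, intervalIntegral.integral_neg]
    ring
  have h1 := tendsto_integral_angKernelDeriv hGc hGd
  have h2 := (tendsto_angKernel_pi.mul_const (G Real.pi - G (-Real.pi))).const_mul
    (2 * Real.pi)⁻¹
  have h3 := h2.add h1
  rw [zero_mul, mul_zero, zero_add] at h3
  refine h3.congr' ?_
  filter_upwards [eventually_radius] with r hr using (key r hr).symm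

lemma real_mul_mem_unitDisk {ρ : ℝ} (h0 : 0 ≤ ρ) (h1 : ρ < 1) {z : ℂ} (hz : ‖z‖ ≤ 1) :
    (ρ : ℂ) * z ∈ unitDisk := by
  change ‖(ρ : ℂ) * z‖ < 1
  rw [norm_mul, Complex.norm_real, Real.norm_of_nonneg h0]
  nlinarith [norm_nonneg z]

lemma isOpen_unitDisk : IsOpen unitDisk := isOpen_lt continuous_norm continuous_const

lemma unitDisk_eq_ball : unitDisk = Metric.ball 0 1 := by
  ext z
  simp [unitDisk]

lemma diffContOnCl_dilate {f : ℂ → ℂ} (hf : DifferentiableOn ℂ f unitDisk) {ρ : ℝ} (h0 : 0 ≤ ρ)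
    (h1 : ρ < 1) : DiffContOnCl ℂ (fun z => f (ρ * z)) (Metric.ball 0 1) := by
  refine DifferentiableOn.diffContOnCl fun z hz => ?_
  have hz1 : ‖z‖ ≤ 1 := by
    simpa using Metric.closure_ball_subset_closedBall hz
  have h := (hf.differentiableAt (isOpen_unitDisk.mem_nhds (real_mul_mem_unitDisk h0 h1 hz1)))
  exact (DifferentiableAt.comp z h (by fun_prop)).differentiableWithinAt

/-- The Poisson integral of `t ↦ i e^{it} F'(e^{it})`, integrated by parts. -/
lemma I_mul_eq_integral {f F : ℂ → ℂ} (hf : DifferentiableOn ℂ f unitDisk)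
    {F' : ℂ → ℂ} (hF : ∀ z ∈ unitDisk, HasDerivAt F (f z) z) (hF'c : Continuous F')
    (hF' : EqOn F F' unitDisk) (θ : ℝ) {r : ℝ} (h0 : 0 < r) (h1 : r < 1) :
    I * (r * circlePt θ) * f (r * circlePt θ) =
      (2 * Real.pi)⁻¹ • ∫ t in (-Real.pi)..Real.pi, (-angKernelDeriv r t) •
        F' (circleMap 0 1 (θ + t)) := by
  set z : ℂ := r * circlePt θ with hz
  have hzm : z ∈ unitDisk := real_mul_mem_unitDisk h0.le h1 (norm_circlePt θ).le
  have key : ∀ ρ : ℝ, 0 < ρ ∧ ρ < 1 → I * (ρ * z) * f (ρ * z) =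
      (2 * Real.pi)⁻¹ • ∫ t in (-Real.pi)..Real.pi, (-angKernelDeriv r t) •
        F' (ρ * circleMap 0 1 (θ + t)) := by
    rintro ρ ⟨hρ0, hρ1⟩
    have hd : DifferentiableOn ℂ (fun w => I * w * f w) unitDisk := by fun_prop
    have h := (diffContOnCl_dilate hd hρ0.le hρ1).circleAverage_poissonKernel_smul (w := z)
      (unitDisk_eq_ball ▸ hzm)
    rw [hz, circleAverage_poissonKernel_eq_intervalIntegral, ← hz] at h
    have hm : ∀ t : ℝ, (ρ : ℂ) * circleMap 0 1 (θ + t) ∈ unitDisk := fun t =>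
      real_mul_mem_unitDisk hρ0.le hρ1 (by simp)
    have hv : ∀ t : ℝ, HasDerivAt (fun t : ℝ => F (ρ * circleMap 0 1 (θ + t)))
        (I * (ρ * circleMap 0 1 (θ + t)) * f (ρ * circleMap 0 1 (θ + t))) t := by
      intro t
      have hi := ((hasDerivAt_circleMap 0 1 (θ + t)).comp_const_add θ t).const_mul (ρ : ℂ)
      have := (hF _ (hm t)).comp t hi
      convert! this using 1
      ring
    have hvc : Continuous fun t : ℝ => I * (ρ * circleMap 0 1 (θ + t)) *
        f (ρ * circleMap 0 1 (θ + t)) := by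
      have : Continuous fun t : ℝ => f (ρ * circleMap 0 1 (θ + t)) :=
        hf.continuousOn.comp_continuous (by fun_prop) hm
      exact Continuous.mul (by fun_prop) this
    have hF0 : ∀ t : ℝ, F' (ρ * circleMap 0 1 (θ + t)) = F (ρ * circleMap 0 1 (θ + t)) :=
      fun t => (hF' (hm t)).symm
    have hbp := intervalIntegral.integral_smul_deriv_eq_deriv_smul (a := -Real.pi) (b := Real.pi)
      (fun t _ => hasDerivAt_angKernel h0.le h1 t) (fun t _ => hv t)
      ((continuous_angKernelDeriv h0.le h1).intervalIntegrable _ _) (hvc.intervalIntegrable _ _)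
    rw [← h, hbp]
    have he : angKernel r (-Real.pi) = angKernel r Real.pi := by simp [angKernel]
    have hper : circleMap 0 1 (θ + -Real.pi) = circleMap 0 1 (θ + Real.pi) := by
      rw [← periodic_circleMap 0 1 (θ + -Real.pi)]
      congr 1
      ring
    simp only [he, hper, sub_self, zero_sub, neg_smul, intervalIntegral.integral_neg, hF0]
  have hl : Tendsto (fun ρ : ℝ => I * (ρ * z) * f (ρ * z)) (nhdsWithin 1 (Iio 1))
      (nhds (I * z * f z)) := by
    have h2 : ContinuousAt (fun ρ : ℝ => I * (ρ * z) * f (ρ * z)) 1 := by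
      have : ContinuousAt (fun ρ : ℝ => f (ρ * z)) 1 := by
        refine ContinuousAt.comp (g := f) ?_ (Continuous.continuousAt (by fun_prop))
        exact (hf.differentiableAt (isOpen_unitDisk.mem_nhds (by simpa using hzm))).continuousAt
      exact ContinuousAt.mul (Continuous.continuousAt (by fun_prop)) this
    simpa using h2.tendsto.mono_left nhdsWithin_le_nhds
  have hr : Tendsto (fun ρ : ℝ => (2 * Real.pi)⁻¹ • ∫ t in (-Real.pi)..Real.pi,
      (-angKernelDeriv r t) • F' (ρ * circleMap 0 1 (θ + t))) (nhdsWithin 1 (Iio 1))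
      (nhds ((2 * Real.pi)⁻¹ • ∫ t in (-Real.pi)..Real.pi,
      (-angKernelDeriv r t) • F' (circleMap 0 1 (θ + t)))) := by
    have hk := continuous_angKernelDeriv h0.le h1
    have h2 : Continuous fun ρ : ℝ => (2 * Real.pi)⁻¹ • ∫ t in (-Real.pi)..Real.pi,
      (-angKernelDeriv r t) • F' (ρ * circleMap 0 1 (θ + t)) := by
      refine Continuous.fun_const_smul
        (intervalIntegral.continuous_parametric_intervalIntegral_of_continuous' ?_ _ _) _
      unfold Function.uncurry
      fun_prop
    simpa using (h2.tendsto 1).mono_left nhdsWithin_le_nhds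
  refine tendsto_nhds_unique (hl.congr' ?_) hr
  filter_upwards [eventually_radius] with ρ hρ using key ρ hρ

/-- **Fatou's theorem**: a bounded analytic function has radial limits a.e. -/
theorem ae_exists_radLim {f : ℂ → ℂ} (hf : DifferentiableOn ℂ f unitDisk) {M : ℝ}
    (hM : ∀ z ∈ unitDisk, ‖f z‖ ≤ M) : ∀ᵐ θ : ℝ, ∃ w, RadLim f θ w := by
  obtain ⟨F, hF⟩ := DifferentiableOn.isExactOn_ball (unitDisk_eq_ball ▸ hf)
  rw [← unitDisk_eq_ball] at hF
  have hLip : LipschitzOnWith M.toNNReal F unitDisk := by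
    refine Convex.lipschitzOnWith_of_nnnorm_hasDerivWithin_le (f' := f) ?_
      (fun z hz => (hF z hz).hasDerivWithinAt) fun z hz => ?_
    · rw [unitDisk_eq_ball]
      exact convex_ball 0 1
    · exact NNReal.le_toNNReal_of_coe_le (hM z hz)
  obtain ⟨F', hF'L, hF'⟩ := hLip.extend_finite_dimension
  have hL := hF'L.comp (lipschitzWith_circleMap 0 1)
  filter_upwards [hL.ae_differentiableAt_real] with θ hθ
  have hc : Continuous fun t : ℝ => F' (circleMap 0 1 (θ + t)) :=
    hF'L.continuous.comp (by fun_prop)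
  have hd : HasDerivAt (fun t : ℝ => F' (circleMap 0 1 (θ + t)))
      (deriv (F' ∘ circleMap 0 1) θ) 0 := by
    have h := hθ.hasDerivAt
    nth_rewrite 2 [← add_zero θ] at h
    exact h.comp_const_add θ 0
  have h1 := tendsto_integral_angKernelDeriv hc hd
  have h2 : Tendsto (fun r : ℝ => I * (r * circlePt θ)) (nhdsWithin 1 (Iio 1))
      (nhds (I * (((1 : ℝ) : ℂ) * circlePt θ))) :=
    (Continuous.tendsto (by fun_prop) _).mono_left nhdsWithin_le_nhds
  have hne : circlePt θ ≠ 0 := Complex.exp_ne_zero _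
  refine ⟨_, Tendsto.congr' ?_ (h1.div h2 (by simp [hne]))⟩
  filter_upwards [eventually_radius] with r ⟨hr0, hr1⟩
  simp only [Pi.div_apply]
  rw [← I_mul_eq_integral hf hF hF'L.continuous hF' θ hr0 hr1]
  have : (r : ℂ) ≠ 0 := by exact_mod_cast hr0.ne'
  field_simp [I_ne_zero]

lemma circlePt_mem_sphere (θ : ℝ) : circlePt θ ∈ Metric.sphere (0 : ℂ) 1 := by
  simp [norm_circlePt]

lemma le_poissonKernel {z : ℂ} (hz : z ∈ unitDisk) (θ : ℝ) :
    (1 - ‖z‖) / (1 + ‖z‖) ≤ poissonKernel 0 z (circleMap 0 1 θ) := by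
  have h := le_re_herglotzRieszKernel (circlePt_mem_sphere θ) (unitDisk_eq_ball ▸ hz)
  rw [poissonKernel_eq_re_herglotzRieszKernel, circleMap_eq_circlePt]
  simpa [herglotzRieszKernel] using h

lemma poissonKernel_pos {z : ℂ} (hz : z ∈ unitDisk) (θ : ℝ) :
    0 < poissonKernel 0 z (circleMap 0 1 θ) := by
  have hz' : ‖z‖ < 1 := hz
  exact (div_pos (by linarith) (by positivity)).trans_le (le_poissonKernel hz θ)

lemma continuous_poissonKernel_circleMap {z : ℂ} (hz : z ∈ unitDisk) :
    Continuous fun θ : ℝ => poissonKernel 0 z (circleMap 0 1 θ) := by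
  rw [poissonKernel_eq_re_herglotzRieszKernel]
  refine continuous_re.comp ?_
  exact (continuousOn_herglotzRieszKernel_sphere (unitDisk_eq_ball ▸ hz)).comp_continuous
    (by fun_prop) fun θ => by simp

lemma integral_poissonKernel {z : ℂ} (hz : z ∈ unitDisk) :
    (2 * Real.pi)⁻¹ * ∫ θ in (0 : ℝ)..2 * Real.pi, poissonKernel 0 z (circleMap 0 1 θ) = 1 := by
  have h := (diffContOnCl_const (c := (1 : ℂ))).circleAverage_poissonKernel_smul
    (unitDisk_eq_ball ▸ hz)
  rw [Real.circleAverage_def] at h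
  simp only [Pi.smul_apply', Complex.real_smul, mul_one, intervalIntegral.integral_ofReal] at h
  exact_mod_cast h

lemma poissonInt_eq (u : ℂ → ℝ) (z : ℂ) : poissonInt u z = (2 * Real.pi)⁻¹ *
    ∫ θ in (0 : ℝ)..2 * Real.pi, poissonKernel 0 z (circleMap 0 1 θ) * u (circleMap 0 1 θ) := by
  rw [poissonInt, Real.circleAverage_def]
  simp

/-- The radial boundary function of `f`. -/
def bdry (f : ℂ → ℂ) (ζ : ℂ) : ℂ := limUnder (nhdsWithin 1 (Iio 1)) fun r : ℝ => f (r * ζ)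

lemma RadLim.bdry_eq {f : ℂ → ℂ} {θ : ℝ} {w : ℂ} (h : RadLim f θ w) : bdry f (circlePt θ) = w :=
  Tendsto.limUnder_eq h

lemma RadLim.radLim_bdry {f : ℂ → ℂ} {θ : ℝ} {w : ℂ} (h : RadLim f θ w) :
    RadLim f θ (bdry f (circlePt θ)) := by
  rwa [h.bdry_eq]

lemma RadLim.norm_le {f : ℂ → ℂ} {M : ℝ} (hM : ∀ z ∈ unitDisk, ‖f z‖ ≤ M) {θ : ℝ} {w : ℂ}
    (h : RadLim f θ w) : ‖w‖ ≤ M := by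
  refine le_of_tendsto h.norm ?_
  filter_upwards [eventually_radius] with r hr
  exact hM _ (real_mul_mem_unitDisk hr.1.le hr.2 (norm_circlePt θ).le)

lemma ae_radLim_bdry {f : ℂ → ℂ} (hf : DifferentiableOn ℂ f unitDisk) {M : ℝ}
    (hM : ∀ z ∈ unitDisk, ‖f z‖ ≤ M) : ∀ᵐ θ : ℝ, RadLim f θ (bdry f (circlePt θ)) := by
  filter_upwards [ae_exists_radLim hf hM] with θ ⟨w, hw⟩ using hw.radLim_bdry

/-- A sequence of radii increasing to `1`. -/
def radius (n : ℕ) : ℝ := 1 - 1 / ((n : ℝ) + 1 + 1)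

lemma radius_pos (n : ℕ) : 0 < radius n := by
  have : 1 / ((n : ℝ) + 1 + 1) < 1 := by
    rw [div_lt_one (by positivity)]
    linarith [(Nat.cast_nonneg n : (0 : ℝ) ≤ n)]
  rw [radius]
  linarith

lemma radius_lt_one (n : ℕ) : radius n < 1 := by
  have : 0 < 1 / ((n : ℝ) + 1 + 1) := by positivity
  rw [radius]
  linarith

lemma tendsto_radius : Tendsto radius atTop (nhdsWithin 1 (Iio 1)) := by
  refine tendsto_nhdsWithin_iff.2 ⟨?_, Eventually.of_forall radius_lt_one⟩
  have h := (tendsto_one_div_add_atTop_nhds_zero_nat (𝕜 := ℝ)).comp (tendsto_add_atTop_nat 1)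
  have := h.const_sub 1
  simp only [sub_zero] at this
  refine this.congr fun n => ?_
  simp [radius]

lemma continuous_dilate_circleMap {f : ℂ → ℂ} (hf : DifferentiableOn ℂ f unitDisk) {ρ : ℝ}
    (h0 : 0 ≤ ρ) (h1 : ρ < 1) : Continuous fun θ : ℝ => f (ρ * circleMap 0 1 θ) :=
  hf.continuousOn.comp_continuous (by fun_prop) fun θ => real_mul_mem_unitDisk h0 h1 (by simp)

lemma aestronglyMeasurable_bdry {f : ℂ → ℂ} (hf : DifferentiableOn ℂ f unitDisk) {M : ℝ}
    (hM : ∀ z ∈ unitDisk, ‖f z‖ ≤ M) :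
    AEStronglyMeasurable (fun θ : ℝ => bdry f (circleMap 0 1 θ)) volume := by
  refine aestronglyMeasurable_of_tendsto_ae atTop
    (f := fun n (θ : ℝ) => f (radius n * circleMap 0 1 θ))
    (fun n => (continuous_dilate_circleMap hf (radius_pos n).le
      (radius_lt_one n)).aestronglyMeasurable) ?_
  filter_upwards [ae_radLim_bdry hf hM] with θ hθ
  rw [circleMap_eq_circlePt]
  exact hθ.comp tendsto_radius

/-- Poisson representation of a bounded analytic function by its boundary function. -/
lemma poisson_bdry {f : ℂ → ℂ} (hf : DifferentiableOn ℂ f unitDisk) {M : ℝ}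
    (hM : ∀ z ∈ unitDisk, ‖f z‖ ≤ M) {z : ℂ} (hz : z ∈ unitDisk) :
    f z = (2 * Real.pi)⁻¹ • ∫ θ in (0 : ℝ)..2 * Real.pi,
      poissonKernel 0 z (circleMap 0 1 θ) • bdry f (circleMap 0 1 θ) := by
  have hK := continuous_poissonKernel_circleMap hz
  have h1 : ∀ n, f (radius n * z) = (2 * Real.pi)⁻¹ • ∫ θ in (0 : ℝ)..2 * Real.pi,
      poissonKernel 0 z (circleMap 0 1 θ) • f (radius n * circleMap 0 1 θ) := fun n => by
    have h := (diffContOnCl_dilate hf (radius_pos n).le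
      (radius_lt_one n)).circleAverage_poissonKernel_smul (unitDisk_eq_ball ▸ hz)
    rw [Real.circleAverage_def] at h
    exact h.symm
  have h2 : Tendsto (fun n => f (radius n * z)) atTop (nhds (f z)) := by
    have hc : ContinuousAt (fun ρ : ℝ => f (ρ * z)) 1 := by
      refine ContinuousAt.comp (g := f) ?_ (Continuous.continuousAt (by fun_prop))
      exact (hf.differentiableAt (isOpen_unitDisk.mem_nhds (by simpa using hz))).continuousAt
    have := hc.tendsto.comp (tendsto_radius.mono_right nhdsWithin_le_nhds)
    simpa [Function.comp_def] using this
  refine tendsto_nhds_unique h2 ?_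
  simp_rw [h1]
  refine Tendsto.const_smul ?_ _
  refine intervalIntegral.tendsto_integral_filter_of_dominated_convergence
    (fun θ => poissonKernel 0 z (circleMap 0 1 θ) * M)
    (Eventually.of_forall fun n => ?_) (Eventually.of_forall fun n => ae_of_all _ fun θ _ => ?_)
    ((hK.mul continuous_const).intervalIntegrable _ _) ?_
  · exact (hK.smul (continuous_dilate_circleMap hf (radius_pos n).le
      (radius_lt_one n))).aestronglyMeasurable
  · rw [norm_smul, Real.norm_of_nonneg (poissonKernel_pos hz θ).le]
    exact mul_le_mul_of_nonneg_left (hM _ (real_mul_mem_unitDisk (radius_pos n).le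
      (radius_lt_one n) (by simp))) (poissonKernel_pos hz θ).le
  · filter_upwards [ae_radLim_bdry hf hM] with θ hθ _
    rw [circleMap_eq_circlePt]
    exact (hθ.comp tendsto_radius).const_smul _

/-- **Smirnov's maximum principle** for bounded analytic functions. -/
lemma norm_le_one_of_ae_radLim {f : ℂ → ℂ} (hf : DifferentiableOn ℂ f unitDisk) {M : ℝ}
    (hM : ∀ z ∈ unitDisk, ‖f z‖ ≤ M) (hb : ∀ᵐ θ : ℝ, ∀ w, RadLim f θ w → ‖w‖ ≤ 1) :
    ∀ z ∈ unitDisk, ‖f z‖ ≤ 1 := by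
  intro z hz
  have hpi := Real.pi_pos
  have hK := continuous_poissonKernel_circleMap hz
  rw [poisson_bdry hf hM hz, norm_smul, Real.norm_of_nonneg (by positivity)]
  refine le_of_le_of_eq ?_ (integral_poissonKernel hz)
  refine mul_le_mul_of_nonneg_left ?_ (by positivity)
  refine intervalIntegral.norm_integral_le_of_norm_le (by positivity) ?_
    (hK.intervalIntegrable _ _)
  filter_upwards [hb, ae_radLim_bdry hf hM] with θ h1 h2 _
  rw [norm_smul, Real.norm_of_nonneg (poissonKernel_pos hz θ).le, circleMap_eq_circlePt]
  exact mul_le_of_le_one_right (by rw [← circleMap_eq_circlePt]; exact (poissonKernel_pos hz θ).le)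
    (h1 _ h2)

lemma intervalIntegrable_poissonKernel_mul {u : ℂ → ℝ} (hu : CircleIntegrable u 0 1) {z : ℂ}
    (hz : z ∈ unitDisk) : IntervalIntegrable
      (fun θ => poissonKernel 0 z (circleMap 0 1 θ) * u (circleMap 0 1 θ)) volume 0 (2 * Real.pi) :=
  IntervalIntegrable.continuousOn_mul hu (continuous_poissonKernel_circleMap hz).continuousOn

lemma poissonInt_mono {u v : ℂ → ℝ} (hu : CircleIntegrable u 0 1) (hv : CircleIntegrable v 0 1)
    (huv : ∀ᵐ θ : ℝ, u (circlePt θ) ≤ v (circlePt θ)) {z : ℂ} (hz : z ∈ unitDisk) :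
    poissonInt u z ≤ poissonInt v z := by
  have hpi := Real.pi_pos
  rw [poissonInt_eq, poissonInt_eq]
  refine mul_le_mul_of_nonneg_left ?_ (by positivity)
  refine intervalIntegral.integral_mono_ae (by positivity)
    (intervalIntegrable_poissonKernel_mul hu hz) (intervalIntegrable_poissonKernel_mul hv hz) ?_
  filter_upwards [huv] with θ hθ
  rw [← circleMap_eq_circlePt] at hθ
  exact mul_le_mul_of_nonneg_left hθ (poissonKernel_pos hz θ).le

lemma poissonInt_const (a : ℝ) {z : ℂ} (hz : z ∈ unitDisk) : poissonInt (fun _ => a) z = a := by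
  rw [poissonInt_eq, intervalIntegral.integral_mul_const, ← mul_assoc, integral_poissonKernel hz,
    one_mul]

lemma poissonInt_add {u v : ℂ → ℝ} (hu : CircleIntegrable u 0 1) (hv : CircleIntegrable v 0 1)
    {z : ℂ} (hz : z ∈ unitDisk) :
    poissonInt (fun ζ => u ζ + v ζ) z = poissonInt u z + poissonInt v z := by
  rw [poissonInt_eq, poissonInt_eq, poissonInt_eq, ← mul_add, ← intervalIntegral.integral_add
    (intervalIntegrable_poissonKernel_mul hu hz) (intervalIntegrable_poissonKernel_mul hv hz)]
  simp only [mul_add]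

/-- The outer function whose modulus has boundary values `exp u`. -/
def outerFn (u : ℂ → ℝ) (z : ℂ) : ℂ :=
  Complex.exp (Real.circleAverage (fun ζ => herglotzRieszKernel 0 z ζ • (u ζ : ℂ)) 0 1)

lemma outerFn_ne_zero (u : ℂ → ℝ) (z : ℂ) : outerFn u z ≠ 0 := Complex.exp_ne_zero _

lemma norm_outerFn {u : ℂ → ℝ} (hu : CircleIntegrable u 0 1) {z : ℂ} (hz : z ∈ unitDisk) :
    ‖outerFn u z‖ = Real.exp (poissonInt u z) := by
  rw [outerFn, Complex.norm_exp, re_circleAverage_herglotzRieszKernel_smul hu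
    (unitDisk_eq_ball ▸ hz), poissonInt, poissonKernel_eq_re_herglotzRieszKernel]

lemma differentiableOn_outerFn {u : ℂ → ℝ} (hu : CircleIntegrable u 0 1) :
    DifferentiableOn ℂ (outerFn u) unitDisk := by
  have hu' : CircleIntegrable (fun ζ => (u ζ : ℂ)) 0 1 := by
    have h : IntervalIntegrable (fun θ => u (circleMap 0 1 θ)) volume 0 (2 * Real.pi) := hu
    exact ⟨h.1.ofReal, h.2.ofReal⟩
  intro z hz
  exact (hasDerivAt_circleAverage_herglotzRieszKernel_smul hu'
    (unitDisk_eq_ball ▸ hz)).cexp.differentiableAt.differentiableWithinAt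

lemma ae_tendsto_norm_outerFn {u : ℂ → ℝ} (hu : CircleIntegrable u 0 1) :
    ∀ᵐ θ : ℝ, Tendsto (fun r : ℝ => ‖outerFn u (r * circlePt θ)‖) (nhdsWithin 1 (Iio 1))
      (nhds (Real.exp (u (circlePt θ)))) := by
  filter_upwards [ae_tendsto_poissonInt hu] with θ hθ
  refine ((Real.continuous_exp.tendsto _).comp hθ).congr' ?_
  filter_upwards [eventually_radius] with r hr
  rw [norm_outerFn hu (real_mul_mem_unitDisk hr.1.le hr.2 (norm_circlePt θ).le)]
  rfl

lemma circleIntegrable_max_const {u : ℂ → ℝ} (hu : CircleIntegrable u 0 1) (a : ℝ) :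
    CircleIntegrable (fun ζ => max (u ζ) a) 0 1 := by
  have h : IntervalIntegrable (fun θ => u (circleMap 0 1 θ)) volume 0 (2 * Real.pi) := hu
  have hc : IntervalIntegrable (fun _ : ℝ => a) volume 0 (2 * Real.pi) :=
    intervalIntegrable_const
  exact ⟨h.1.sup hc.1, h.2.sup hc.2⟩

lemma norm_le_exp_poissonInt_of_bddBelow {g : ℂ → ℂ} (hg : SchurFn g) {u : ℂ → ℝ}
    (hu : CircleIntegrable u 0 1) {a : ℝ} (ha : ∀ ζ, a ≤ u ζ)
    (hb : ∀ᵐ θ : ℝ, ∀ w, RadLim g θ w → ‖w‖ ≤ Real.exp (u (circlePt θ))) {z : ℂ}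
    (hz : z ∈ unitDisk) : ‖g z‖ ≤ Real.exp (poissonInt u z) := by
  have hf : DifferentiableOn ℂ (fun z => g z / outerFn u z) unitDisk :=
    hg.1.div (differentiableOn_outerFn hu) fun z _ => outerFn_ne_zero u z
  have hM : ∀ z ∈ unitDisk, ‖g z / outerFn u z‖ ≤ 1 / Real.exp a := by
    intro z hz
    rw [norm_div, norm_outerFn hu hz]
    have h : a ≤ poissonInt u z := by
      rw [← poissonInt_const a hz]
      exact poissonInt_mono (circleIntegrable_const _ _ _) hu (ae_of_all _ fun θ => ha _) hz
    gcongr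
    exact hg.2 z hz
  have := norm_le_one_of_ae_radLim hf hM ?_ z hz
  · rwa [norm_div, norm_outerFn hu hz, div_le_one (Real.exp_pos _)] at this
  filter_upwards [hb, ae_tendsto_norm_outerFn hu, ae_radLim_bdry hg.1 hg.2] with θ h1 h2 h3 w hw
  have h4 := h3.norm.div h2 (Real.exp_pos _).ne'
  have h5 : ‖w‖ = ‖bdry g (circlePt θ)‖ / Real.exp (u (circlePt θ)) := by
    refine tendsto_nhds_unique hw.norm (h4.congr fun r => ?_)
    simp
  rw [h5, div_le_one (Real.exp_pos _)]
  exact h1 _ h3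

/-- A Schur function whose boundary modulus is dominated by `exp u` is dominated by the modulus
of the outer function with boundary modulus `exp u`. -/
theorem norm_le_exp_poissonInt {g : ℂ → ℂ} (hg : SchurFn g) {u : ℂ → ℝ}
    (hu : CircleIntegrable u 0 1)
    (hb : ∀ᵐ θ : ℝ, ∀ w, RadLim g θ w → ‖w‖ ≤ Real.exp (u (circlePt θ))) {z : ℂ}
    (hz : z ∈ unitDisk) : ‖g z‖ ≤ Real.exp (poissonInt u z) := by
  have h1 : ∀ n : ℕ, ‖g z‖ ≤ Real.exp (poissonInt (fun ζ => max (u ζ) (-n)) z) := fun n => by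
    refine norm_le_exp_poissonInt_of_bddBelow hg (circleIntegrable_max_const hu _)
      (fun ζ => le_max_right _ _) ?_ hz
    filter_upwards [hb] with θ hθ w hw
    exact (hθ w hw).trans (Real.exp_le_exp.2 (le_max_left _ _))
  suffices ht : Tendsto (fun n : ℕ => poissonInt (fun ζ => max (u ζ) (-n)) z) atTop
      (nhds (poissonInt u z)) from ge_of_tendsto' ((Real.continuous_exp.tendsto _).comp ht) h1
  simp_rw [poissonInt_eq]
  refine Tendsto.const_mul _ ?_
  refine intervalIntegral.tendsto_integral_filter_of_dominated_convergence
    (fun θ => ‖poissonKernel 0 z (circleMap 0 1 θ) * u (circleMap 0 1 θ)‖)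
    (Eventually.of_forall fun n => ?_) (Eventually.of_forall fun n => ae_of_all _ fun θ _ => ?_)
    (intervalIntegrable_poissonKernel_mul hu hz).norm (ae_of_all _ fun θ _ => ?_)
  · exact (intervalIntegrable_poissonKernel_mul (circleIntegrable_max_const hu _)
      hz).def'.aestronglyMeasurable
  · rw [norm_mul, norm_mul]
    refine mul_le_mul_of_nonneg_left ?_ (norm_nonneg _)
    rw [Real.norm_eq_abs, Real.norm_eq_abs]
    have hn : (0 : ℝ) ≤ n := n.cast_nonneg
    rcases le_total (u (circleMap 0 1 θ)) (-n) with h | h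
    · rw [max_eq_right h, abs_of_nonpos (by linarith), abs_of_nonpos (by linarith)]
      linarith
    · rw [max_eq_left h]
  · refine tendsto_const_nhds.congr' ?_
    filter_upwards [eventually_ge_atTop ⌈-u (circleMap 0 1 θ)⌉₊] with n hn
    have := Nat.ceil_le.1 hn
    rw [max_eq_left (by linarith)]

lemma integral_neg_le_of_log_le_poissonInt {u : ℂ → ℝ} (hu : CircleIntegrable u 0 1)
    (hu0 : ∀ᵐ θ : ℝ, u (circlePt θ) ≤ 0) {z : ℂ} (hz : z ∈ unitDisk) {L : ℝ}
    (hL : L ≤ poissonInt u z) : ∫ θ in (0 : ℝ)..2 * Real.pi, -u (circleMap 0 1 θ) ≤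
      2 * Real.pi * -L / ((1 - ‖z‖) / (1 + ‖z‖)) := by
  have hpi := Real.pi_pos
  have hz' : ‖z‖ < 1 := hz
  have hc : 0 < (1 - ‖z‖) / (1 + ‖z‖) := div_pos (by linarith) (by positivity)
  have hu' : IntervalIntegrable (fun θ => u (circleMap 0 1 θ)) volume 0 (2 * Real.pi) := hu
  rw [le_div_iff₀ hc, ← intervalIntegral.integral_mul_const]
  have h1 : ∫ θ in (0 : ℝ)..2 * Real.pi, -u (circleMap 0 1 θ) * ((1 - ‖z‖) / (1 + ‖z‖)) ≤
      ∫ θ in (0 : ℝ)..2 * Real.pi, -(poissonKernel 0 z (circleMap 0 1 θ) * u (circleMap 0 1 θ)) := by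
    refine intervalIntegral.integral_mono_ae (by positivity) (hu'.neg.mul_const _)
      (intervalIntegrable_poissonKernel_mul hu hz).neg ?_
    filter_upwards [hu0] with θ hθ
    rw [← circleMap_eq_circlePt] at hθ
    have := le_poissonKernel hz θ
    nlinarith
  rw [poissonInt_eq] at hL
  rw [intervalIntegral.integral_neg] at h1
  have h2 := mul_le_mul_of_nonneg_left hL (by positivity : 0 ≤ 2 * Real.pi)
  rw [mul_inv_cancel_left₀ (by positivity)] at h2
  linarith

lemma circleIntegrable_log_max {g : ℂ → ℂ} (hg : SchurFn g) {a : ℝ} (ha : a ≤ 0) :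
    CircleIntegrable (fun ζ => Real.log (max ‖bdry g ζ‖ (Real.exp a))) 0 1 := by
  have hpi := Real.pi_pos
  rw [CircleIntegrable, intervalIntegrable_iff_integrableOn_Ioc_of_le (by positivity)]
  refine Integrable.of_bound (C := |a|) ?_ ?_
  · have h := (aestronglyMeasurable_bdry hg.1 hg.2).norm.aemeasurable
    exact (((h.max aemeasurable_const).log).restrict).aestronglyMeasurable
  · refine ae_restrict_of_ae ?_
    filter_upwards [ae_radLim_bdry hg.1 hg.2] with θ hθ
    rw [circleMap_eq_circlePt]
    have h1 := hθ.norm_le hg.2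
    have h2 : a ≤ Real.log (max ‖bdry g (circlePt θ)‖ (Real.exp a)) := by
      rw [Real.le_log_iff_exp_le (lt_max_of_lt_right (Real.exp_pos a))]
      exact le_max_right _ _
    have h3 : Real.log (max ‖bdry g (circlePt θ)‖ (Real.exp a)) ≤ 0 :=
      Real.log_nonpos (le_max_of_le_right (Real.exp_pos a).le)
        (max_le h1 (Real.exp_le_one_iff.2 ha))
    rw [Real.norm_eq_abs, abs_of_nonpos h3, abs_of_nonpos ha]
    linarith

/-- **Szegő's theorem**: the boundary function of a nonzero Schur function is log-integrable and
nonzero a.e. -/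
theorem log_bdry_integrable {g : ℂ → ℂ} (hg : SchurFn g) {z : ℂ} (hz : z ∈ unitDisk)
    (hgz : g z ≠ 0) : CircleIntegrable (fun ζ => Real.log ‖bdry g ζ‖) 0 1 ∧
      ∀ᵐ θ ∂(volume.restrict (Ioc 0 (2 * Real.pi))), bdry g (circlePt θ) ≠ 0 := by
  have hpi := Real.pi_pos
  set μ := volume.restrict (Ioc 0 (2 * Real.pi)) with hμ
  set D : ℝ → ℂ := fun θ => bdry g (circleMap 0 1 θ) with hD
  have hDm : AEMeasurable (fun θ => ‖D θ‖) μ :=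
    (aestronglyMeasurable_bdry hg.1 hg.2).norm.aemeasurable.restrict
  have hrl := ae_radLim_bdry hg.1 hg.2
  have hD1 : ∀ᵐ θ, ‖D θ‖ ≤ 1 := by
    filter_upwards [hrl] with θ hθ
    simp only [hD, circleMap_eq_circlePt]
    exact hθ.norm_le hg.2
  set u : ℕ → ℂ → ℝ := fun n ζ => Real.log (max ‖bdry g ζ‖ (Real.exp (-n))) with hu
  have hui : ∀ n, CircleIntegrable (u n) 0 1 := fun n => circleIntegrable_log_max hg (by simp)
  have hu0 : ∀ n, ∀ᵐ θ : ℝ, u n (circlePt θ) ≤ 0 := fun n => by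
    filter_upwards [hD1] with θ hθ
    simp only [hD, circleMap_eq_circlePt] at hθ
    exact Real.log_nonpos (le_max_of_le_right (Real.exp_pos _).le)
      (max_le hθ (Real.exp_le_one_iff.2 (by simp)))
  have hL : ∀ n, Real.log ‖g z‖ ≤ poissonInt (u n) z := fun n => by
    rw [Real.log_le_iff_le_exp (norm_pos_iff.2 hgz)]
    refine norm_le_exp_poissonInt hg (hui n) ?_ hz
    filter_upwards with θ w hw
    rw [Real.exp_log (lt_max_of_lt_right (Real.exp_pos _)), hw.bdry_eq]
    exact le_max_left _ _
  obtain ⟨C, hC⟩ : ∃ C, ∀ n, ∫⁻ θ, ENNReal.ofReal (-u n (circleMap 0 1 θ)) ∂μ ≤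
      ENNReal.ofReal C := by
    refine ⟨2 * Real.pi * -Real.log ‖g z‖ / ((1 - ‖z‖) / (1 + ‖z‖)), fun n => ?_⟩
    have h1 := integral_neg_le_of_log_le_poissonInt (hui n) (hu0 n) hz (hL n)
    have h2 : IntervalIntegrable (fun θ => u n (circleMap 0 1 θ)) volume 0 (2 * Real.pi) := hui n
    rw [intervalIntegrable_iff_integrableOn_Ioc_of_le (by positivity)] at h2
    rw [intervalIntegral.integral_of_le (by positivity)] at h1
    have h3 : Integrable (fun θ => -u n (circleMap 0 1 θ)) μ := Integrable.neg h2
    rw [← ofReal_integral_eq_lintegral_ofReal h3]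
    · exact ENNReal.ofReal_le_ofReal h1
    · refine ae_restrict_of_ae ?_
      filter_upwards [hu0 n] with θ hθ
      rw [← circleMap_eq_circlePt] at hθ
      simpa using hθ
  have hlim : ∀ θ, Tendsto (fun n => ENNReal.ofReal (-u n (circleMap 0 1 θ))) atTop
      (nhds (if D θ = 0 then ⊤ else ENNReal.ofReal (-Real.log ‖D θ‖))) := by
    intro θ
    split_ifs with h0
    · have : ∀ n, ENNReal.ofReal (-u n (circleMap 0 1 θ)) = (n : ENNReal) := fun n => by
        simp only [hD] at h0
        simp [hu, h0, max_eq_right (Real.exp_pos _).le]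
      simp_rw [this]
      exact ENNReal.tendsto_nat_nhds_top
    · refine tendsto_const_nhds.congr' ?_
      have hpos : 0 < ‖D θ‖ := norm_pos_iff.2 h0
      filter_upwards [eventually_ge_atTop ⌈-Real.log ‖D θ‖⌉₊] with n hn
      have h1 := Nat.ceil_le.1 hn
      have h2 : Real.exp (-n) ≤ ‖D θ‖ := by
        rw [← Real.le_log_iff_exp_le hpos]
        linarith
      simp only [hu]
      rw [max_eq_left h2]
  have hmeas : ∀ n, AEMeasurable (fun θ => ENNReal.ofReal (-u n (circleMap 0 1 θ))) μ := fun n =>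
    ((hDm.max aemeasurable_const).log).neg.ennreal_ofReal
  have hfat : ∫⁻ θ, (if D θ = 0 then ⊤ else ENNReal.ofReal (-Real.log ‖D θ‖)) ∂μ < ⊤ := by
    simp_rw [← fun θ => (hlim θ).liminf_eq]
    refine (lintegral_liminf_le' hmeas).trans_lt ?_
    refine lt_of_le_of_lt ?_ (ENNReal.ofReal_lt_top (r := C))
    exact (liminf_le_liminf (Eventually.of_forall hC)).trans_eq (by simp)
  have hne : ∀ᵐ θ ∂μ, D θ ≠ 0 := by
    filter_upwards [ae_lt_top' (aemeasurable_of_tendsto_metrizable_ae atTop hmeas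
      (ae_of_all _ hlim)) hfat.ne] with θ hθ h0
    rw [if_pos h0] at hθ
    exact lt_irrefl _ hθ
  refine ⟨?_, ?_⟩
  · rw [CircleIntegrable, intervalIntegrable_iff_integrableOn_Ioc_of_le (by positivity)]
    refine ⟨hDm.log.aestronglyMeasurable, ?_⟩
    rw [hasFiniteIntegral_iff_norm]
    refine lt_of_eq_of_lt (lintegral_congr_ae ?_) hfat
    filter_upwards [hne, ae_restrict_of_ae hD1] with θ h0 h1
    rw [if_neg h0, Real.norm_eq_abs, abs_of_nonpos (Real.log_nonpos (norm_nonneg _) h1)]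
  · filter_upwards [hne] with θ hθ
    rwa [← circleMap_eq_circlePt]

lemma differentiableAt_reflect {f : ℂ → ℂ} {z : ℂ} (hz : z ≠ 0)
    (hf : DifferentiableAt ℂ f (conj z)⁻¹) :
    DifferentiableAt ℂ (fun w => conj (f (conj w)⁻¹)) z := by
  have h : DifferentiableAt ℂ (fun w => f w⁻¹) (conj z) :=
    DifferentiableAt.comp (g := f) _ hf (differentiableAt_inv (by simpa using hz))
  have := h.conj_conj
  rw [conj_conj] at this
  exact this

lemma inv_conj_mul_circlePt (r θ : ℝ) :
    (conj ((r : ℂ) * circlePt θ))⁻¹ = ((r⁻¹ : ℝ) : ℂ) * circlePt θ := by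
  have : conj (circlePt θ) = (circlePt θ)⁻¹ := by
    rw [Complex.inv_def, Complex.normSq_eq_norm_sq, norm_circlePt]
    simp
  rw [map_mul, Complex.conj_ofReal, this, mul_inv, inv_inv, Complex.ofReal_inv]

lemma inv_conj_mem_extDisk {z : ℂ} (hz : z ∈ unitDisk) (h0 : z ≠ 0) : (conj z)⁻¹ ∈ extDisk := by
  change 1 < ‖(conj z)⁻¹‖
  rw [norm_inv, RCLike.norm_conj]
  exact (one_lt_inv₀ (norm_pos_iff.2 h0)).2 hz

lemma inv_conj_mem_unitDisk {z : ℂ} (hz : z ∈ extDisk) : (conj z)⁻¹ ∈ unitDisk := by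
  change ‖(conj z)⁻¹‖ < 1
  rw [norm_inv, RCLike.norm_conj]
  exact inv_lt_one_of_one_lt₀ hz

lemma ne_zero_of_mem_extDisk {z : ℂ} (hz : z ∈ extDisk) : z ≠ 0 := by
  rintro rfl
  have : (1 : ℝ) < ‖(0 : ℂ)‖ := hz
  rw [norm_zero] at this
  linarith

lemma isOpen_extDisk : IsOpen extDisk := isOpen_lt continuous_const continuous_norm

lemma tendsto_inv_nhdsLT_one :
    Tendsto (fun r : ℝ => r⁻¹) (nhdsWithin 1 (Iio 1)) (nhdsWithin 1 (Ioi 1)) := by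
  refine tendsto_nhdsWithin_iff.2 ⟨?_, ?_⟩
  · have := (tendsto_inv₀ (one_ne_zero (α := ℝ))).mono_left
      (nhdsWithin_le_nhds (s := Iio (1 : ℝ)))
    simpa using this
  · filter_upwards [eventually_radius] with r hr using (one_lt_inv₀ hr.1).2 hr.2

lemma tendsto_inv_nhdsGT_one :
    Tendsto (fun r : ℝ => r⁻¹) (nhdsWithin 1 (Ioi 1)) (nhdsWithin 1 (Iio 1)) := by
  refine tendsto_nhdsWithin_iff.2 ⟨?_, ?_⟩
  · have := (tendsto_inv₀ (one_ne_zero (α := ℝ))).mono_left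
      (nhdsWithin_le_nhds (s := Ioi (1 : ℝ)))
    simpa using this
  · filter_upwards [self_mem_nhdsWithin] with r hr using inv_lt_one_of_one_lt₀ (mem_Ioi.1 hr)

/-- The reflection in the circle of a contractive analytic function on the exterior disk is a
Schur function. -/
lemma exists_schurFn_reflect {f : ℂ → ℂ} (hf : DifferentiableOn ℂ f extDisk)
    (hb : ∀ z ∈ extDisk, ‖f z‖ ≤ 1) :
    ∃ g, SchurFn g ∧ ∀ z ∈ unitDisk, z ≠ 0 → g z = conj (f (conj z)⁻¹) := by
  set G : ℂ → ℂ := fun w => conj (f (conj w)⁻¹) with hG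
  have h0 : unitDisk ∈ nhds (0 : ℂ) := isOpen_unitDisk.mem_nhds (by simp [unitDisk])
  have hd : DifferentiableOn ℂ G (unitDisk \ {0}) := by
    rintro z ⟨hz, hz0⟩
    exact (differentiableAt_reflect hz0 (hf.differentiableAt
      (isOpen_extDisk.mem_nhds (inv_conj_mem_extDisk hz hz0)))).differentiableWithinAt
  have hbG : ∀ z ∈ unitDisk, z ≠ 0 → ‖G z‖ ≤ 1 := fun z hz hz0 => by
    rw [hG, RCLike.norm_conj]
    exact hb _ (inv_conj_mem_extDisk hz hz0)
  have hbdd : BddAbove (norm ∘ G '' (unitDisk \ {0})) := by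
    refine ⟨1, ?_⟩
    rintro _ ⟨z, ⟨hz, hz0⟩, rfl⟩
    exact hbG z hz hz0
  have hD := Complex.differentiableOn_update_limUnder_of_bddAbove h0 hd hbdd
  have hne : ∀ z ≠ 0, Function.update G 0 (limUnder (nhdsWithin 0 {0}ᶜ) G) z = G z :=
    fun z hz => Function.update_of_ne hz _ _
  refine ⟨_, ⟨hD, fun z hz => ?_⟩, fun z _ hz0 => hne z hz0⟩
  rcases eq_or_ne z 0 with rfl | hz0
  · have hc := ((hD.differentiableAt h0).continuousAt.norm.tendsto).mono_left
      (nhdsWithin_le_nhds (s := {0}ᶜ))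
    refine le_of_tendsto hc ?_
    filter_upwards [self_mem_nhdsWithin, mem_nhdsWithin_of_mem_nhds h0] with w hw hw1
    rw [hne w hw]
    exact hbG w hw1 hw
  · rw [hne z hz0]
    exact hbG z hz hz0

lemma conjTranspose_mul_self_eq_one {τ c w : ℂ} (hτ : conj τ * τ = 1)
    (hc : conj c * c + conj w * w = 1) :
    (!![τ * conj w, -(τ * conj c); c, w] : Matrix (Fin 2) (Fin 2) ℂ)ᴴ *
      !![τ * conj w, -(τ * conj c); c, w] = 1 := by
  ext i j
  fin_cases i <;> fin_cases j <;>
    simp [Matrix.mul_apply, Fin.sum_univ_two]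
  · linear_combination conj w * w * hτ + hc
  · linear_combination -conj c * w * hτ
  · linear_combination -c * conj w * hτ
  · linear_combination conj c * c * hτ + hc

lemma circleIntegrable_indicator {u : ℂ → ℝ} (hu : CircleIntegrable u 0 1) {A : Set ℂ}
    (hA : NullMeasurableSet (circleMap 0 1 ⁻¹' A)) : CircleIntegrable (A.indicator u) 0 1 := by
  have hpi := Real.pi_pos
  have hu' : IntervalIntegrable (fun θ => u (circleMap 0 1 θ)) volume 0 (2 * Real.pi) := hu
  rw [intervalIntegrable_iff_integrableOn_Ioc_of_le (by positivity)] at hu'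
  rw [CircleIntegrable, intervalIntegrable_iff_integrableOn_Ioc_of_le (by positivity)]
  have := hu'.indicator₀ (hA.mono_ac Measure.restrict_le_self.absolutelyContinuous)
  exact this

lemma RadLim.mul {f g : ℂ → ℂ} {θ : ℝ} {a b : ℂ} (hf : RadLim f θ a) (hg : RadLim g θ b) :
    RadLim (fun z => f z * g z) θ (a * b) := Tendsto.mul hf hg

lemma schurFn_const {a : ℂ} (ha : ‖a‖ ≤ 1) : SchurFn fun _ => a :=
  ⟨differentiableOn_const _, fun _ _ => ha⟩

lemma schurFn_outerFn {u : ℂ → ℝ} (hu : CircleIntegrable u 0 1)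
    (hu0 : ∀ᵐ θ : ℝ, u (circlePt θ) ≤ 0) : SchurFn (outerFn u) := by
  refine ⟨differentiableOn_outerFn hu, fun z hz => ?_⟩
  rw [norm_outerFn hu hz, Real.exp_le_one_iff, ← poissonInt_const 0 hz]
  exact poissonInt_mono hu (circleIntegrable_const _ _ _) hu0 hz

lemma schurFn_div {f g : ℂ → ℂ} (hf : DifferentiableOn ℂ f unitDisk)
    (hg : DifferentiableOn ℂ g unitDisk) (hg0 : ∀ z ∈ unitDisk, g z ≠ 0)
    (hfg : ∀ z ∈ unitDisk, ‖f z‖ ≤ ‖g z‖) : SchurFn fun z => f z / g z := by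
  refine ⟨hf.div hg hg0, fun z hz => ?_⟩
  rw [norm_div]
  exact div_le_one_of_le₀ (hfg z hz) (norm_nonneg _)

lemma SchurFn.ae_radLim {f : ℂ → ℂ} (hf : SchurFn f) :
    ∀ᵐ θ : ℝ, RadLim f θ (bdry f (circlePt θ)) := ae_radLim_bdry hf.1 hf.2

lemma conj_mul_self_eq (w : ℂ) : conj w * w = ((‖w‖ ^ 2 : ℝ) : ℂ) := by
  rw [Complex.conj_mul']
  norm_cast

lemma norm_one_sub_conj_mul_self {w : ℂ} (hw : ‖w‖ ≤ 1) : ‖1 - conj w * w‖ = 1 - ‖w‖ ^ 2 := by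
  rw [conj_mul_self_eq, ← Complex.ofReal_one, ← Complex.ofReal_sub, Complex.norm_real,
    Real.norm_of_nonneg]
  nlinarith [norm_nonneg w]

lemma exists_unitary_of_eq_mul {s g₁ g₂ : ℂ → ℂ} {γ : Set ℝ}
    (hs : SchurFn s) (hg₁ : SchurFn g₁) (hg₂ : SchurFn g₂)
    (hγ : γ ⊆ Ioc 0 (2 * Real.pi)) (hne : ∃ z ∈ unitDisk, g₂ z ≠ 0)
    (hrel : ∀ᵐ θ ∂(volume.restrict γ),
      conj (bdry s (circlePt θ)) * bdry g₂ (circlePt θ) = bdry g₁ (circlePt θ))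
    (h0 : ∀ z ∈ unitDisk, g₂ z = s z * g₁ z) :
    ∃ S : ℂ → Matrix (Fin 2) (Fin 2) ℂ,
      (∀ i j, SchurFn fun z => S z i j) ∧ (∀ z, S z 1 1 = s z) ∧ UnitaryAEOn S γ := by
  obtain ⟨z₀, hz₀, hg₂z₀⟩ := hne
  have hnz := ae_restrict_of_ae_restrict_of_subset hγ (log_bdry_integrable hg₂ hz₀ hg₂z₀).2
  refine ⟨fun z => !![1, 0; 0, s z], ?_, fun z => by simp, ?_⟩
  · intro i j
    fin_cases i <;> fin_cases j
    · simpa using schurFn_const (a := 1) (by simp)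
    · simpa using schurFn_const (a := 0) (by simp)
    · simpa using schurFn_const (a := 0) (by simp)
    · simpa using hs
  · filter_upwards [hrel, hnz, ae_restrict_of_ae hs.ae_radLim, ae_restrict_of_ae hg₁.ae_radLim,
      ae_restrict_of_ae hg₂.ae_radLim] with θ h1 h2 hsθ h1θ h2θ
    set w := bdry s (circlePt θ) with hw
    have h3 : bdry g₂ (circlePt θ) = w * bdry g₁ (circlePt θ) := by
      refine tendsto_nhds_unique h2θ ((hsθ.mul h1θ).congr' ?_)
      filter_upwards [eventually_radius] with r hr
      exact (h0 _ (real_mul_mem_unitDisk hr.1.le hr.2 (norm_circlePt θ).le)).symm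
    have h4 : conj w * w = 1 := by
      refine mul_right_cancel₀ h2 ?_
      rw [one_mul]
      nth_rewrite 2 [h3]
      rw [← h1]
      ring
    refine ⟨!![1, 0; 0, w], ?_, ?_⟩
    · intro i j
      fin_cases i <;> fin_cases j
      · exact (tendsto_const_nhds : RadLim (fun _ => 1) θ 1)
      · exact (tendsto_const_nhds : RadLim (fun _ => 0) θ 0)
      · exact (tendsto_const_nhds : RadLim (fun _ => 0) θ 0)
      · simpa using hsθ
    · ext i j
      fin_cases i <;> fin_cases j <;> simp [Matrix.mul_apply, Fin.sum_univ_two, h4]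

/-- The completion of `s` by outer functions, from a factorization `conj s · g₂ = g₁` of
boundary values on the arc. -/
theorem exists_unitary_of_bdry_relation {s g₁ g₂ : ℂ → ℂ} {γ : Set ℝ}
    (hs : SchurFn s) (hg₁ : SchurFn g₁) (hg₂ : SchurFn g₂)
    (hh : SchurFn fun z => g₂ z - s z * g₁ z)
    (hγ : γ ⊆ Ioc 0 (2 * Real.pi)) (hne : ∃ z ∈ unitDisk, g₂ z ≠ 0)
    (hrel : ∀ᵐ θ ∂(volume.restrict γ),
      conj (bdry s (circlePt θ)) * bdry g₂ (circlePt θ) = bdry g₁ (circlePt θ)) :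
    ∃ S : ℂ → Matrix (Fin 2) (Fin 2) ℂ,
      (∀ i j, SchurFn fun z => S z i j) ∧ (∀ z, S z 1 1 = s z) ∧ UnitaryAEOn S γ := by
  by_cases h0 : ∀ z ∈ unitDisk, g₂ z - s z * g₁ z = 0
  · exact exists_unitary_of_eq_mul hs hg₁ hg₂ hγ hne hrel fun z hz => sub_eq_zero.1 (h0 z hz)
  push Not at h0
  set h : ℂ → ℂ := fun z => g₂ z - s z * g₁ z with hhdef
  obtain ⟨z₀, hz₀, hg₂z₀⟩ := hne
  obtain ⟨z₁, hz₁, hhz₁⟩ := h0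
  obtain ⟨hlg, hg₂ne⟩ := log_bdry_integrable hg₂ hz₀ hg₂z₀
  obtain ⟨hlh, hhne⟩ := log_bdry_integrable hh hz₁ hhz₁
  set A : Set ℂ := {ζ | conj (bdry s ζ) * bdry g₂ ζ = bdry g₁ ζ ∧ bdry g₂ ζ ≠ 0 ∧ bdry h ζ ≠ 0}
    with hA
  have hAm : NullMeasurableSet (circleMap 0 1 ⁻¹' A) := by
    have ms := (aestronglyMeasurable_bdry hs.1 hs.2).aemeasurable
    have m1 := (aestronglyMeasurable_bdry hg₁.1 hg₁.2).aemeasurable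
    have m2 := (aestronglyMeasurable_bdry hg₂.1 hg₂.2).aemeasurable
    have mh := (aestronglyMeasurable_bdry hh.1 hh.2).aemeasurable
    have mc : AEMeasurable (fun θ : ℝ => conj (bdry s (circleMap 0 1 θ))) volume :=
      continuous_conj.measurable.comp_aemeasurable ms
    exact (nullMeasurableSet_eq_fun (mc.mul m2) m1).inter
      ((nullMeasurableSet_eq_fun m2 aemeasurable_const).compl.inter
        (nullMeasurableSet_eq_fun mh aemeasurable_const).compl)
  set e : ℂ → ℝ := A.indicator fun ζ => Real.log ‖bdry g₂ ζ‖ with he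
  set v : ℂ → ℝ := A.indicator fun ζ => (Real.log ‖bdry h ζ‖ - Real.log ‖bdry g₂ ζ‖) / 2 with hv
  have hei : CircleIntegrable e 0 1 := circleIntegrable_indicator hlg hAm
  have hdi : CircleIntegrable (fun ζ => (Real.log ‖bdry h ζ‖ - Real.log ‖bdry g₂ ζ‖) / 2) 0 1 :=
    (IntervalIntegrable.sub hlh hlg).div_const 2
  have hvi : CircleIntegrable v 0 1 := circleIntegrable_indicator hdi hAm
  have hvvi : CircleIntegrable (fun ζ => v ζ + v ζ) 0 1 := IntervalIntegrable.add hvi hvi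
  have hki : CircleIntegrable (fun ζ => e ζ + (v ζ + v ζ)) 0 1 := IntervalIntegrable.add hei hvvi
  have hbh : ∀ᵐ θ : ℝ, bdry h (circlePt θ) = bdry g₂ (circlePt θ) -
      bdry s (circlePt θ) * bdry g₁ (circlePt θ) := by
    filter_upwards [hs.ae_radLim, hg₁.ae_radLim, hg₂.ae_radLim] with θ h1 h2 h3
    exact RadLim.bdry_eq (Tendsto.sub h3 (h1.mul h2))
  have hbhA : ∀ᵐ θ : ℝ, circlePt θ ∈ A → bdry h (circlePt θ) = bdry g₂ (circlePt θ) *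
      (1 - conj (bdry s (circlePt θ)) * bdry s (circlePt θ)) := by
    filter_upwards [hbh] with θ h1 h2
    rw [h1, ← h2.1]
    ring
  have hs1 : ∀ᵐ θ : ℝ, ‖bdry s (circlePt θ)‖ ≤ 1 := by
    filter_upwards [hs.ae_radLim] with θ hθ using hθ.norm_le hs.2
  have hexp_e : ∀ ζ ∈ A, Real.exp (e ζ) = ‖bdry g₂ ζ‖ := fun ζ hζ => by
    rw [he, indicator_of_mem hζ, Real.exp_log (norm_pos_iff.2 hζ.2.1)]
  have hexp_v : ∀ ζ ∈ A, Real.exp (v ζ + v ζ) = ‖bdry h ζ‖ / ‖bdry g₂ ζ‖ := fun ζ hζ => by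
    rw [hv, indicator_of_mem hζ, add_halves, Real.exp_sub, Real.exp_log (norm_pos_iff.2 hζ.2.2),
      Real.exp_log (norm_pos_iff.2 hζ.2.1)]
  have hexp_k : ∀ ζ ∈ A, Real.exp (e ζ + (v ζ + v ζ)) = ‖bdry h ζ‖ := fun ζ hζ => by
    rw [Real.exp_add, hexp_e ζ hζ, hexp_v ζ hζ, mul_div_cancel₀ _ (norm_ne_zero_iff.2 hζ.2.1)]
  have hoff_e : ∀ ζ ∉ A, e ζ = 0 := fun ζ hζ => indicator_of_notMem hζ _
  have hoff_v : ∀ ζ ∉ A, v ζ = 0 := fun ζ hζ => indicator_of_notMem hζ _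
  have he0 : ∀ᵐ θ : ℝ, e (circlePt θ) ≤ 0 := by
    filter_upwards [hg₂.ae_radLim] with θ hθ
    by_cases hm : circlePt θ ∈ A
    · rw [← Real.exp_le_one_iff, hexp_e _ hm]
      exact hθ.norm_le hg₂.2
    · exact (hoff_e _ hm).le
  have hv0 : ∀ᵐ θ : ℝ, v (circlePt θ) ≤ 0 := by
    filter_upwards [hbhA, hs1] with θ h1 h2
    by_cases hm : circlePt θ ∈ A
    · suffices v (circlePt θ) + v (circlePt θ) ≤ 0 by linarith
      rw [← Real.exp_le_one_iff, hexp_v _ hm, h1 hm, norm_mul,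
        mul_div_cancel_left₀ _ (norm_ne_zero_iff.2 hm.2.1), norm_one_sub_conj_mul_self h2]
      nlinarith [norm_nonneg (bdry s (circlePt θ))]
    · exact (hoff_v _ hm).le
  have hE := schurFn_outerFn hei he0
  have hc := schurFn_outerFn hvi hv0
  have hg₁E : ∀ z ∈ unitDisk, ‖g₁ z‖ ≤ ‖outerFn e z‖ := fun z hz => by
    rw [norm_outerFn hei hz]
    refine norm_le_exp_poissonInt hg₁ hei ?_ hz
    filter_upwards [hs1] with θ h1 w hw
    by_cases hm : circlePt θ ∈ A
    · rw [hexp_e _ hm, ← hw.bdry_eq, ← hm.1, norm_mul, RCLike.norm_conj]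
      exact mul_le_of_le_one_left (norm_nonneg _) h1
    · rw [hoff_e _ hm, Real.exp_zero]
      exact hw.norm_le hg₁.2
  have hhEc : ∀ z ∈ unitDisk, ‖-h z‖ ≤ ‖outerFn e z * outerFn v z‖ := fun z hz => by
    rw [norm_neg, norm_mul, norm_outerFn hei hz]
    have h1 : ‖h z‖ ≤ Real.exp (poissonInt (fun ζ => e ζ + (v ζ + v ζ)) z) := by
      refine norm_le_exp_poissonInt hh hki (ae_of_all _ fun θ w hw => ?_) hz
      by_cases hm : circlePt θ ∈ A
      · rw [hexp_k _ hm, hw.bdry_eq]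
      · rw [hoff_e _ hm, hoff_v _ hm, add_zero, add_zero, Real.exp_zero]
        exact hw.norm_le hh.2
    rw [poissonInt_add hei hvvi hz, poissonInt_add hvi hvi hz, Real.exp_add, Real.exp_add,
      ← norm_outerFn hvi hz] at h1
    refine h1.trans (mul_le_mul_of_nonneg_left ?_ (Real.exp_pos _).le)
    exact mul_le_of_le_one_left (norm_nonneg _) (hc.2 z hz)
  refine ⟨fun z => !![g₁ z / outerFn e z, -h z / (outerFn e z * outerFn v z); outerFn v z, s z],
    ?_, fun z => by simp, ?_⟩
  · intro i j
    fin_cases i <;> fin_cases j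
    · simpa using schurFn_div hg₁.1 hE.1 (fun z _ => outerFn_ne_zero e z) hg₁E
    · simpa using schurFn_div hh.1.neg (hE.1.mul hc.1)
        (fun z _ => mul_ne_zero (outerFn_ne_zero e z) (outerFn_ne_zero v z)) hhEc
    · simpa using hc
    · simpa using hs
  filter_upwards [hrel, ae_restrict_of_ae_restrict_of_subset hγ hg₂ne,
    ae_restrict_of_ae_restrict_of_subset hγ hhne, ae_restrict_of_ae hs.ae_radLim,
    ae_restrict_of_ae hg₁.ae_radLim, ae_restrict_of_ae hh.ae_radLim,
    ae_restrict_of_ae hE.ae_radLim, ae_restrict_of_ae hc.ae_radLim,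
    ae_restrict_of_ae (ae_tendsto_norm_outerFn hei), ae_restrict_of_ae (ae_tendsto_norm_outerFn hvi),
    ae_restrict_of_ae hbhA, ae_restrict_of_ae hs1]
    with θ r1 n2 nh ls l1 lh lE lc tE tc bh bs
  have hm : circlePt θ ∈ A := ⟨r1, n2, nh⟩
  have hbh' := bh hm
  have nE : ‖bdry (outerFn e) (circlePt θ)‖ = ‖bdry g₂ (circlePt θ)‖ := by
    rw [← hexp_e _ hm]
    exact tendsto_nhds_unique lE.norm tE
  have nc : ‖bdry (outerFn v) (circlePt θ)‖ ^ 2 = 1 - ‖bdry s (circlePt θ)‖ ^ 2 := by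
    rw [tendsto_nhds_unique lc.norm tc, sq, ← Real.exp_add, hexp_v _ hm, hbh', norm_mul,
      mul_div_cancel_left₀ _ (norm_ne_zero_iff.2 n2), norm_one_sub_conj_mul_self bs]
  have hE0 : bdry (outerFn e) (circlePt θ) ≠ 0 := by
    rw [← norm_ne_zero_iff, nE, norm_ne_zero_iff]
    exact n2
  have hc0 : bdry (outerFn v) (circlePt θ) ≠ 0 := by
    rw [← norm_ne_zero_iff, tendsto_nhds_unique lc.norm tc]
    exact (Real.exp_pos _).ne'
  set W := bdry s (circlePt θ)
  set C := bdry (outerFn v) (circlePt θ)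
  set E' := bdry (outerFn e) (circlePt θ)
  set G := bdry g₂ (circlePt θ)
  have hCW : conj C * C + conj W * W = 1 := by
    rw [conj_mul_self_eq, conj_mul_self_eq, nc]
    push_cast
    ring
  have hτ : conj (G / E') * (G / E') = 1 := by
    rw [conj_mul_self_eq, norm_div, nE, div_self (norm_ne_zero_iff.2 n2)]
    simp
  refine ⟨_, ?_, conjTranspose_mul_self_eq_one hτ hCW⟩
  intro i j
  fin_cases i <;> fin_cases j
  · have : RadLim (fun z => g₁ z / outerFn e z) θ (G / E' * conj W) := by
      have h1 : RadLim (fun z => g₁ z / outerFn e z) θ _ := Tendsto.div l1 lE hE0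
      rw [← r1] at h1
      convert! h1 using 1
      ring
    simpa using this
  · have : RadLim (fun z => -h z / (outerFn e z * outerFn v z)) θ (-(G / E' * conj C)) := by
      have h1 : RadLim (fun z => -h z / (outerFn e z * outerFn v z)) θ _ :=
        Tendsto.div (Tendsto.neg lh) (lE.mul lc) (mul_ne_zero hE0 hc0)
      convert! h1 using 1
      rw [hbh', show 1 - conj W * W = conj C * C by rw [← hCW]; ring]
      field_simp
    simpa using this
  · simpa using lc
  · simpa using ls

lemma IsArc.subset {γ : Set ℝ} (hγ : IsArc γ) : γ ⊆ Ioc 0 (2 * Real.pi) := by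
  obtain ⟨a, b, ha, -, hb, rfl⟩ := hγ
  exact fun θ hθ => ⟨ha.trans_lt hθ.1, hθ.2.le.trans hb⟩

lemma IsArc.exists_of_ae {γ : Set ℝ} (hγ : IsArc γ) {p : ℝ → Prop}
    (hp : ∀ᵐ θ ∂(volume.restrict γ), p θ) : ∃ θ, p θ := by
  obtain ⟨a, b, -, hab, -, rfl⟩ := hγ
  have : NeBot (ae (volume.restrict (Ioo a b))) := by
    rw [ae_neBot, Ne, Measure.restrict_eq_zero, Real.volume_Ioo]
    simpa using hab
  exact hp.exists

lemma SchurFn.div_two {f : ℂ → ℂ} (hf : SchurFn f) : SchurFn fun z => f z / 2 := by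
  refine ⟨hf.1.div_const 2, fun z hz => ?_⟩
  rw [norm_div, Complex.norm_ofNat]
  linarith [hf.2 z hz]

lemma RadLim.div_two {f : ℂ → ℂ} {θ : ℝ} {w : ℂ} (h : RadLim f θ w) :
    RadLim (fun z => f z / 2) θ (w / 2) := Tendsto.div_const h 2

/-- If `ft = f₁ / f₂` off the zeros of `f₂`, and `g₁`, `g₂` are the reflections of `f₁`, `f₂`, then
a boundary value `w` of `ft` satisfies `conj w * g₂ = g₁`. -/
lemma conj_mul_eq_of_radLim {ft f₁ f₂ g₁ g₂ : ℂ → ℂ} {θ : ℝ} {w w₁ w₂ : ℂ}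
    (hft : ∀ z ∈ extDisk, f₂ z ≠ 0 → ft z = f₁ z / f₂ z)
    (hg₁ : ∀ z ∈ unitDisk, z ≠ 0 → g₁ z = conj (f₁ (conj z)⁻¹))
    (hg₂ : ∀ z ∈ unitDisk, z ≠ 0 → g₂ z = conj (f₂ (conj z)⁻¹))
    (h₁ : RadLim g₁ θ w₁) (h₂ : RadLim g₂ θ w₂) (hw₂ : w₂ ≠ 0) (hw : RadLimExt ft θ w) :
    conj w * w₂ = w₁ := by
  have hw' : Tendsto (fun r : ℝ => ft (r * circlePt θ)) (nhdsWithin 1 (Ioi 1)) (nhds w) := hw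
  have hlim : Tendsto (fun r : ℝ => conj (ft ((r⁻¹ : ℝ) * circlePt θ))) (nhdsWithin 1 (Iio 1))
      (nhds (conj w)) :=
    (continuous_conj.tendsto _).comp (hw'.comp tendsto_inv_nhdsLT_one)
  have hdiv : RadLim (fun z => g₁ z / g₂ z) θ (w₁ / w₂) := Tendsto.div h₁ h₂ hw₂
  have heq : conj w = w₁ / w₂ := by
    refine tendsto_nhds_unique hlim (hdiv.congr' ?_)
    filter_upwards [eventually_radius, h₂.eventually_ne hw₂] with r hr hne
    have hz := real_mul_mem_unitDisk hr.1.le hr.2 (norm_circlePt θ).le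
    have hz0 : (r : ℂ) * circlePt θ ≠ 0 := by
      rw [← norm_pos_iff, norm_mul, norm_circlePt, mul_one, Complex.norm_real]
      exact norm_pos_iff.2 hr.1.ne'
    rw [hg₂ _ hz hz0] at hne
    rw [hg₁ _ hz hz0, hg₂ _ hz hz0, ← inv_conj_mul_circlePt,
      hft _ (inv_conj_mem_extDisk hz hz0) ((map_ne_zero _).1 hne), map_div₀]
  rw [heq, div_mul_cancel₀ _ hw₂]

theorem exists_unitary_of_pcArc {s : ℂ → ℂ} {γ : Set ℝ} (hγ : IsArc γ) (hs : SchurFn s)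
    (h : PCArc s γ) :
    ∃ S : ℂ → Matrix (Fin 2) (Fin 2) ℂ,
      (∀ i j, SchurFn fun z => S z i j) ∧ (∀ z, S z 1 1 = s z) ∧ UnitaryAEOn S γ := by
  obtain ⟨ft, ⟨f₁, f₂, hf₁, hf₂, hb₁, hb₂, ⟨z₀, hz₀, hfz₀⟩, hft⟩, hpc⟩ := h
  obtain ⟨g₁, hg₁, he₁⟩ := exists_schurFn_reflect hf₁ hb₁
  obtain ⟨g₂, hg₂, he₂⟩ := exists_schurFn_reflect hf₂ hb₂
  have hz₁ := inv_conj_mem_unitDisk hz₀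
  have hgz₁ : g₂ (conj z₀)⁻¹ ≠ 0 := by
    rw [he₂ _ hz₁ (by simpa using ne_zero_of_mem_extDisk hz₀), map_inv₀, conj_conj, inv_inv]
    exact (map_ne_zero _).2 hfz₀
  have hne := ae_restrict_of_ae_restrict_of_subset hγ.subset (log_bdry_integrable hg₂ hz₁ hgz₁).2
  refine exists_unitary_of_bdry_relation hs hg₁.div_two hg₂.div_two ⟨?_, fun z hz => ?_⟩
    hγ.subset ⟨_, hz₁, div_ne_zero hgz₁ two_ne_zero⟩ ?_
  · exact hg₂.div_two.1.sub (hs.1.mul hg₁.div_two.1)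
  · have hm : ‖s z * (g₁ z / 2)‖ ≤ 1 / 2 := by
      rw [norm_mul, norm_div, Complex.norm_ofNat]
      nlinarith [hs.2 z hz, hg₁.2 z hz, norm_nonneg (s z), norm_nonneg (g₁ z)]
    have hn : ‖g₂ z / 2‖ ≤ 1 / 2 := by
      rw [norm_div, Complex.norm_ofNat]
      linarith [hg₂.2 z hz]
    exact (norm_sub_le _ _).trans (by linarith)
  · filter_upwards [hpc, hne, ae_restrict_of_ae hg₁.ae_radLim, ae_restrict_of_ae hg₂.ae_radLim]
      with θ ⟨w, hw, hwe⟩ hn h1 h2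
    rw [hw.bdry_eq, h1.div_two.bdry_eq, h2.div_two.bdry_eq, ← mul_div_assoc,
      conj_mul_eq_of_radLim hft he₁ he₂ h1 h2 hn hwe]

lemma reflect_div_two_contractive {f : ℂ → ℂ} (hf : DifferentiableOn ℂ f unitDisk)
    (hb : ∀ z ∈ unitDisk, ‖f z‖ ≤ 2) :
    DifferentiableOn ℂ (fun z => conj (f (conj z)⁻¹) / 2) extDisk ∧
      ∀ z ∈ extDisk, ‖conj (f (conj z)⁻¹) / 2‖ ≤ 1 := by
  refine ⟨fun z hz => ?_, fun z hz => ?_⟩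
  · exact ((differentiableAt_reflect (ne_zero_of_mem_extDisk hz) (hf.differentiableAt
      (isOpen_unitDisk.mem_nhds (inv_conj_mem_unitDisk hz)))).div_const
        2).differentiableWithinAt
  · rw [norm_div, RCLike.norm_conj, Complex.norm_ofNat]
    linarith [hb _ (inv_conj_mem_unitDisk hz)]

lemma apply_one_one_of_unitary {W : Matrix (Fin 2) (Fin 2) ℂ} (hW : Wᴴ * W = 1) :
    W.det ≠ 0 ∧ W 1 1 = conj (W 0 0) / conj W.det := by
  have hd : conj W.det * W.det = 1 := by
    have := congrArg Matrix.det hW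
    rwa [Matrix.det_mul, Matrix.det_conjTranspose, Matrix.det_one] at this
  have hd0 : W.det ≠ 0 := right_ne_zero_of_mul_eq_one hd
  refine ⟨hd0, ?_⟩
  rw [eq_div_iff ((map_ne_zero _).2 hd0)]
  have h1 := congrFun (congrFun hW 0) 0
  have h2 := congrFun (congrFun hW 0) 1
  simp only [Matrix.mul_apply, Fin.sum_univ_two, Matrix.conjTranspose_apply, Matrix.one_apply_eq,
    Matrix.one_apply_ne zero_ne_one, starRingEnd_apply] at h1 h2 hd ⊢
  rw [Matrix.det_fin_two] at hd ⊢
  have hkey : star (W 0 0) * (W 0 0 * W 1 1 - W 0 1 * W 1 0) = W 1 1 := by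
    linear_combination W 1 1 * h1 - W 1 0 * h2
  linear_combination (-star (W 0 0 * W 1 1 - W 0 1 * W 1 0)) * hkey + star (W 0 0) * hd

/-- The (2,2) entry of a unitary matrix is the conjugate of its (1,1) entry divided by the conjugate
of its determinant, and this quotient continues to the exterior disk by reflection. -/
theorem pcArc_of_unitary {s : ℂ → ℂ} {γ : Set ℝ} (hγ : IsArc γ)
    {S : ℂ → Matrix (Fin 2) (Fin 2) ℂ} (hS : ∀ i j, SchurFn fun z => S z i j)
    (hSs : ∀ z, S z 1 1 = s z) (hU : UnitaryAEOn S γ) : PCArc s γ := by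
  have hdet : ∀ {θ : ℝ} {W : Matrix (Fin 2) (Fin 2) ℂ},
      (∀ i j, RadLim (fun z => S z i j) θ (W i j)) → RadLim (fun z => (S z).det) θ W.det := by
    intro θ W hW
    simp only [Matrix.det_fin_two]
    exact Tendsto.sub ((hW 0 0).mul (hW 1 1)) ((hW 0 1).mul (hW 1 0))
  have hdd : DifferentiableOn ℂ (fun z => (S z).det) unitDisk := by
    simp only [Matrix.det_fin_two]
    exact ((hS 0 0).1.mul (hS 1 1).1).sub ((hS 0 1).1.mul (hS 1 0).1)
  have hdb : ∀ z ∈ unitDisk, ‖(S z).det‖ ≤ 2 := fun z hz => by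
    have hp : ∀ i j k l, ‖S z i j * S z k l‖ ≤ 1 := fun i j k l => by
      rw [norm_mul]
      exact mul_le_one₀ ((hS i j).2 z hz) (norm_nonneg _) ((hS k l).2 z hz)
    rw [Matrix.det_fin_two]
    exact (norm_sub_le _ _).trans (by linarith [hp 0 0 1 1, hp 0 1 1 0])
  obtain ⟨h1d, h1b⟩ := reflect_div_two_contractive (hS 0 0).1
    fun z hz => ((hS 0 0).2 z hz).trans one_le_two
  obtain ⟨h2d, h2b⟩ := reflect_div_two_contractive hdd hdb
  refine ⟨_, ⟨_, _, h1d, h2d, h1b, h2b, ?_, fun z _ _ => rfl⟩, ?_⟩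
  · obtain ⟨θ, W, hW, hWu⟩ := hγ.exists_of_ae hU
    obtain ⟨r, hne, hr⟩ := (((hdet hW).eventually_ne (apply_one_one_of_unitary hWu).1).and
      eventually_radius).exists
    have hz := real_mul_mem_unitDisk hr.1.le hr.2 (norm_circlePt θ).le
    have hz0 : (r : ℂ) * circlePt θ ≠ 0 := by
      rw [← norm_pos_iff, norm_mul, norm_circlePt, mul_one, Complex.norm_real]
      exact norm_pos_iff.2 hr.1.ne'
    refine ⟨_, inv_conj_mem_extDisk hz hz0, div_ne_zero ((map_ne_zero _).2 ?_) two_ne_zero⟩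
    simpa only [map_inv₀, conj_conj, inv_inv] using hne
  · filter_upwards [hU] with θ ⟨W, hW, hWu⟩
    obtain ⟨hd0, h11⟩ := apply_one_one_of_unitary hWu
    have hs : RadLim s θ (W 1 1) := by simpa only [hSs] using hW 1 1
    have hrefl : ∀ {f : ℂ → ℂ} {w : ℂ}, RadLim f θ w →
        RadLimExt (fun z => conj (f (conj z)⁻¹) / 2) θ (conj w / 2) := by
      intro f w hf
      have := ((continuous_conj.tendsto w).comp
        (Tendsto.comp hf tendsto_inv_nhdsGT_one)).div_const 2
      refine this.congr fun r => ?_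
      simp only [Function.comp_apply, inv_conj_mul_circlePt]
    refine ⟨W 1 1, hs, ?_⟩
    have hlim := Tendsto.div (hrefl (hW 0 0)) (hrefl (hdet hW))
      (div_ne_zero ((map_ne_zero _).2 hd0) two_ne_zero)
    rw [div_div_div_cancel_right₀ two_ne_zero, ← h11] at hlim
    exact hlim

/-- local Arov–Douglas–Helton theorem: a Schur function `s` admits a
pseudocontinuation of bounded type across the arc `γ` iff it is the (2,2) entry of a
2×2 matrix function with Schur entries, unitary a.e. on `γ`. -/
theorem statement8 (s : ℂ → ℂ) (γ : Set ℝ) (hγ : IsArc γ) (hs : SchurFn s) :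
    PCArc s γ ↔
      ∃ S : ℂ → Matrix (Fin 2) (Fin 2) ℂ,
        (∀ i j, SchurFn fun z => S z i j) ∧ (∀ z, S z 1 1 = s z) ∧ UnitaryAEOn S γ := by
  refine ⟨exists_unitary_of_pcArc hγ hs, ?_⟩
  rintro ⟨S, hS, hSs, hU⟩
  exact pcArc_of_unitary hγ hS hSs hU
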